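/- (Removability of a point singularity, Proposition 2.4, regularity across the puncture) Let f : D∖{0} → ℝⁿ be smooth and bounded, weakly conformal, with Δf = 0 at every point where ∇f = 0. Assume the energy E(f, D∖{0}) = ∫_{D∖{0}} |∇f|² is finite and the Willmore energy W(f, D∖{0}) is finite. Then for every p' ∈ (1, 4/3), ∫_{D_{1/2}∖{0}} |Δf|^{p'} < ∞, and f extends continuously to 0, i.e. the limit of f(z) as z → 0 exists. -/

import Mathlib

open MeasureTheory Set Filter
open scoped ENNReal Real RealInnerProductSpace

/-- Partial derivative in the first coordinate direction. -/
noncomputable def pd1 {n : ℕ} (f : ℝ × ℝ → EuclideanSpace ℝ (Fin n)) (z : ℝ × ℝ) :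
    EuclideanSpace ℝ (Fin n) := fderiv ℝ f z (1, 0)

/-- Partial derivative in the second coordinate direction. -/
noncomputable def pd2 {n : ℕ} (f : ℝ × ℝ → EuclideanSpace ℝ (Fin n)) (z : ℝ × ℝ) :
    EuclideanSpace ℝ (Fin n) := fderiv ℝ f z (0, 1)

/-- `|∇f|²`. -/
noncomputable def gradSq {n : ℕ} (f : ℝ × ℝ → EuclideanSpace ℝ (Fin n)) (z : ℝ × ℝ) : ℝ :=
    ‖pd1 f z‖ ^ 2 + ‖pd2 f z‖ ^ 2

/-- The Laplacian `Δf = ∂²f/∂x² + ∂²f/∂y²`. -/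
noncomputable def lap {n : ℕ} (f : ℝ × ℝ → EuclideanSpace ℝ (Fin n)) (z : ℝ × ℝ) :
    EuclideanSpace ℝ (Fin n) := pd1 (pd1 f) z + pd2 (pd2 f) z

/-- The Willmore energy `W(f, Ω) = ∫_{Ω ∩ {∇f ≠ 0}} |Δf|²/|∇f|²`. -/
noncomputable def willmore {n : ℕ} (f : ℝ × ℝ → EuclideanSpace ℝ (Fin n))
    (Ω : Set (ℝ × ℝ)) : ℝ≥0∞ :=
  ∫⁻ z in Ω ∩ {w | gradSq f w ≠ 0}, ENNReal.ofReal (‖lap f z‖ ^ 2 / gradSq f z)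

/-- The open disk of radius `r` centered at the origin of `ℝ²`. -/
def disk (r : ℝ) : Set (ℝ × ℝ) := {z | z.1 ^ 2 + z.2 ^ 2 < r ^ 2}

namespace PuncturedDisk

open scoped Topology

section Definitions

variable {G : Type*} [NormedAddCommGroup G] [NormedSpace ℝ G]

/-- Partial derivative in the first coordinate direction, for maps into any normed space. -/
noncomputable def dx (f : ℝ × ℝ → G) (z : ℝ × ℝ) : G := fderiv ℝ f z (1, 0)

/-- Partial derivative in the second coordinate direction, for maps into any normed space. -/
noncomputable def dy (f : ℝ × ℝ → G) (z : ℝ × ℝ) : G := fderiv ℝ f z (0, 1)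

/-- The energy density `|∇f|²`. -/
noncomputable def energyDensity (f : ℝ × ℝ → G) (z : ℝ × ℝ) : ℝ := ‖dx f z‖ ^ 2 + ‖dy f z‖ ^ 2

/-- The Laplacian, for maps into any normed space. -/
noncomputable def laplace (f : ℝ × ℝ → G) (z : ℝ × ℝ) : G := dx (dx f) z + dy (dy f) z

/-- The Willmore density `|Δf|² / |∇f|²`. -/
noncomputable def willmoreDensity (f : ℝ × ℝ → G) (z : ℝ × ℝ) : ℝ :=
  ‖laplace f z‖ ^ 2 / energyDensity f z

/-- The point with polar coordinates `(r, θ)` around `x`. -/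
noncomputable def polarPt (x : ℝ × ℝ) (r θ : ℝ) : ℝ × ℝ :=
  (x.1 + r * Real.cos θ, x.2 + r * Real.sin θ)

/-- The punctured open disk of radius `R` around `x`. -/
def puncDisk (x : ℝ × ℝ) (R : ℝ) : Set (ℝ × ℝ) :=
  {z | 0 < (z.1 - x.1) ^ 2 + (z.2 - x.2) ^ 2 ∧ (z.1 - x.1) ^ 2 + (z.2 - x.2) ^ 2 < R ^ 2}

/-- The integral of `u` over the circle of radius `r` around `x` with respect to the angle. -/
noncomputable def circleInt (x : ℝ × ℝ) (u : ℝ × ℝ → G) (r : ℝ) : G :=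
  ∫ θ in (-π)..π, u (polarPt x r θ)

end Definitions

section Polar

variable {G : Type*} [NormedAddCommGroup G] [NormedSpace ℝ G] {x : ℝ × ℝ} {R r : ℝ}

lemma polarPt_distSq (x : ℝ × ℝ) (r θ : ℝ) :
    ((polarPt x r θ).1 - x.1) ^ 2 + ((polarPt x r θ).2 - x.2) ^ 2 = r ^ 2 := by
  have := Real.sin_sq_add_cos_sq θ
  simp only [polarPt]
  linear_combination r ^ 2 * this

lemma polarPt_mem (hr : 0 < r) (hrR : r < R) (θ : ℝ) : polarPt x r θ ∈ puncDisk x R := by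
  simp only [puncDisk, mem_ofPred_eq, polarPt_distSq]
  exact ⟨by positivity, by gcongr⟩

lemma puncDisk_mono {R' : ℝ} (hR : 0 ≤ R) (h : R ≤ R') : puncDisk x R ⊆ puncDisk x R' :=
  fun _ hz => ⟨hz.1, hz.2.trans_le (by gcongr)⟩

lemma isOpen_puncDisk : IsOpen (puncDisk x R) := by
  have h : Continuous fun z : ℝ × ℝ => (z.1 - x.1) ^ 2 + (z.2 - x.2) ^ 2 := by fun_prop
  exact (isOpen_lt continuous_const h).inter (isOpen_lt h continuous_const)

lemma continuous_polarPt : Continuous fun p : ℝ × ℝ => polarPt x p.1 p.2 := by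
  unfold polarPt; fun_prop

lemma polarPt_periodic : polarPt x r (-π) = polarPt x r π := by simp [polarPt]

lemma exists_polarPt {z : ℝ × ℝ} (hz : z ∈ puncDisk x R) (hR : 0 ≤ R) :
    ∃ r θ, 0 < r ∧ r < R ∧ z = polarPt x r θ := by
  set w : ℂ := ⟨z.1 - x.1, z.2 - x.2⟩ with hw
  have hn : ‖w‖ ^ 2 = (z.1 - x.1) ^ 2 + (z.2 - x.2) ^ 2 := by
    rw [Complex.sq_norm, Complex.normSq_apply, hw]; ring
  have h0 : 0 < ‖w‖ := by
    have := hz.1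
    rw [← hn] at this
    exact norm_pos_iff.2 fun h => by simp [h] at this
  refine ⟨‖w‖, Complex.arg w, h0, ?_, ?_⟩
  · have := hz.2
    rw [← hn] at this
    exact lt_of_pow_lt_pow_left₀ 2 hR this
  · ext <;> simp [polarPt, hw]

lemma continuousOn_comp_polarPt {H : Type*} [TopologicalSpace H] {u : ℝ × ℝ → H}
    (hu : ContinuousOn u (puncDisk x R)) :
    ContinuousOn (fun p : ℝ × ℝ => u (polarPt x p.1 p.2)) (Ioo 0 R ×ˢ univ) :=
  hu.comp continuous_polarPt.continuousOn fun p hp => polarPt_mem hp.1.1 hp.1.2 p.2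

lemma continuous_comp_polarPt {H : Type*} [TopologicalSpace H] {u : ℝ × ℝ → H}
    (hu : ContinuousOn u (puncDisk x R)) (hr : 0 < r) (hrR : r < R) :
    Continuous fun θ => u (polarPt x r θ) :=
  hu.comp_continuous (continuous_polarPt.comp (by fun_prop : Continuous fun θ : ℝ => (r, θ)))
    fun θ => polarPt_mem hr hrR θ

lemma hasDerivAt_polarPt_radius (x : ℝ × ℝ) (r θ : ℝ) :
    HasDerivAt (fun r => polarPt x r θ) (Real.cos θ, Real.sin θ) r := by
  unfold polarPt
  refine HasDerivAt.prodMk ?_ ?_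
  · simpa using ((hasDerivAt_id r).mul_const (Real.cos θ)).const_add x.1
  · simpa using ((hasDerivAt_id r).mul_const (Real.sin θ)).const_add x.2

lemma hasDerivAt_polarPt_angle (x : ℝ × ℝ) (r θ : ℝ) :
    HasDerivAt (fun θ => polarPt x r θ) (-(r * Real.sin θ), r * Real.cos θ) θ := by
  unfold polarPt
  refine HasDerivAt.prodMk ?_ ?_
  · simpa using ((Real.hasDerivAt_cos θ).const_mul r).const_add x.1
  · simpa using ((Real.hasDerivAt_sin θ).const_mul r).const_add x.2

lemma fderiv_apply_eq (u : ℝ × ℝ → G) (z : ℝ × ℝ) (a b : ℝ) :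
    fderiv ℝ u z (a, b) = a • dx u z + b • dy u z := by
  unfold dx dy
  rw [← map_smul, ← map_smul, ← map_add]
  simp

variable {u : ℝ × ℝ → G}

lemma continuousOn_fderiv_puncDisk (hu : ContDiffOn ℝ 1 u (puncDisk x R)) :
    ContinuousOn (fderiv ℝ u) (puncDisk x R) :=
  hu.continuousOn_fderiv_of_isOpen isOpen_puncDisk le_rfl

lemma differentiableAt_puncDisk (hu : ContDiffOn ℝ 1 u (puncDisk x R)) {z : ℝ × ℝ}
    (hz : z ∈ puncDisk x R) : DifferentiableAt ℝ u z :=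
  (hu.differentiableOn one_ne_zero).differentiableAt (isOpen_puncDisk.mem_nhds hz)

lemma continuousOn_dx (hu : ContDiffOn ℝ 1 u (puncDisk x R)) :
    ContinuousOn (dx u) (puncDisk x R) :=
  (continuousOn_fderiv_puncDisk hu).clm_apply continuousOn_const

lemma continuousOn_dy (hu : ContDiffOn ℝ 1 u (puncDisk x R)) :
    ContinuousOn (dy u) (puncDisk x R) :=
  (continuousOn_fderiv_puncDisk hu).clm_apply continuousOn_const

lemma continuousOn_circleInt (hu : ContinuousOn u (puncDisk x R)) :
    ContinuousOn (circleInt x u) (Ioo 0 R) := by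
  have h := continuousOn_comp_polarPt hu
  rw [continuousOn_iff_continuous_domRestrict]
  unfold circleInt
  apply intervalIntegral.continuous_parametric_intervalIntegral_of_continuous'
    (f := fun (r : Ioo 0 R) θ => u (polarPt x r θ))
  exact h.comp_continuous (f := fun p : Ioo 0 R × ℝ => ((p.1 : ℝ), p.2)) (by fun_prop)
    fun p => ⟨p.1.2, mem_univ _⟩

lemma hasDerivAt_comp_radius (hu : ContDiffOn ℝ 1 u (puncDisk x R)) (hr : 0 < r) (hrR : r < R)
    (θ : ℝ) : HasDerivAt (fun r => u (polarPt x r θ))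
      (Real.cos θ • dx u (polarPt x r θ) + Real.sin θ • dy u (polarPt x r θ)) r := by
  rw [← fderiv_apply_eq]
  exact (differentiableAt_puncDisk hu (polarPt_mem hr hrR θ)).hasFDerivAt.comp_hasDerivAt r
    (hasDerivAt_polarPt_radius x r θ)

lemma hasDerivAt_comp_angle (hu : ContDiffOn ℝ 1 u (puncDisk x R)) (hr : 0 < r) (hrR : r < R)
    (θ : ℝ) : HasDerivAt (fun θ => u (polarPt x r θ))
      (-(r * Real.sin θ) • dx u (polarPt x r θ) + (r * Real.cos θ) • dy u (polarPt x r θ)) θ := by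
  rw [← fderiv_apply_eq]
  exact (differentiableAt_puncDisk hu (polarPt_mem hr hrR θ)).hasFDerivAt.comp_hasDerivAt θ
    (hasDerivAt_polarPt_angle x r θ)

lemma hasDerivAt_circleInt [CompleteSpace G] (hu : ContDiffOn ℝ 1 u (puncDisk x R)) (hr : 0 < r)
    (hrR : r < R) :
    HasDerivAt (circleInt x u) (∫ θ in (-π)..π,
      (Real.cos θ • dx u (polarPt x r θ) + Real.sin θ • dy u (polarPt x r θ))) r := by
  set D : ℝ → ℝ → G := fun r θ =>
    Real.cos θ • dx u (polarPt x r θ) + Real.sin θ • dy u (polarPt x r θ) with hD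
  have hDc : ContinuousOn (fun p : ℝ × ℝ => D p.1 p.2) (Ioo 0 R ×ˢ univ) := by
    have h1 := continuousOn_comp_polarPt (continuousOn_dx hu)
    have h2 := continuousOn_comp_polarPt (continuousOn_dy hu)
    simp only [hD]
    fun_prop
  obtain ⟨a, ha0, har⟩ := exists_between hr
  obtain ⟨b, hrb, hbR⟩ := exists_between hrR
  have hsub : Icc a b ×ˢ Icc (-π) π ⊆ Ioo 0 R ×ˢ (univ : Set ℝ) :=
    prod_mono (fun t ht => ⟨ha0.trans_le ht.1, ht.2.trans_lt hbR⟩) (subset_univ _)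
  obtain ⟨C, hC⟩ := (isCompact_Icc.prod isCompact_Icc).exists_bound_of_continuousOn
    (hDc.mono hsub)
  have hcu : ∀ s ∈ Ioo 0 R, Continuous fun θ => u (polarPt x s θ) := fun s hs =>
    continuous_comp_polarPt hu.continuousOn hs.1 hs.2
  have hcD : Continuous (D r) := by
    exact hDc.comp_continuous (f := fun θ : ℝ => (r, θ)) (by fun_prop)
      fun θ => ⟨⟨hr, hrR⟩, mem_univ _⟩
  refine (intervalIntegral.hasDerivAt_integral_of_dominated_loc_of_deriv_le
    (F := fun r θ => u (polarPt x r θ)) (F' := D) (bound := fun _ => C)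
    (s := Icc a b) (Icc_mem_nhds har hrb) ?_ ?_ ?_ ?_ ?_ ?_).2
  · filter_upwards [Ioo_mem_nhds hr hrR] with s hs
    exact (hcu s hs).aestronglyMeasurable
  · exact (hcu r ⟨hr, hrR⟩).intervalIntegrable _ _
  · exact hcD.aestronglyMeasurable
  · refine ae_of_all _ fun θ hθ s hs => ?_
    rw [uIoc_of_le (by linarith [Real.pi_pos])] at hθ
    exact hC (s, θ) ⟨hs, Ioc_subset_Icc_self hθ⟩
  · exact intervalIntegrable_const
  · refine ae_of_all _ fun θ hθ s hs => ?_
    exact hasDerivAt_comp_radius hu (ha0.trans_le hs.1) (hs.2.trans_lt hbR) θ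

lemma integral_angle_deriv [CompleteSpace G] (hu : ContDiffOn ℝ 1 u (puncDisk x R)) (hr : 0 < r)
    (hrR : r < R) : ∫ θ in (-π)..π, (-(r * Real.sin θ) • dx u (polarPt x r θ) +
      (r * Real.cos θ) • dy u (polarPt x r θ)) = 0 := by
  have h1 := continuous_comp_polarPt (continuousOn_dx hu) hr hrR
  have h2 := continuous_comp_polarPt (continuousOn_dy hu) hr hrR
  rw [intervalIntegral.integral_eq_sub_of_hasDerivAt
    (fun θ _ => hasDerivAt_comp_angle hu hr hrR θ)
    (Continuous.intervalIntegrable (by fun_prop) _ _), polarPt_periodic, sub_self]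

/-- If the angular derivative of `w / r` compensates the radial derivative of `u`, up to `d`, then
the circle integral of `u` has derivative the circle integral of `d`. -/
lemma hasDerivAt_circleInt_of_flux [CompleteSpace G] {w : ℝ × ℝ → G}
    (hu : ContDiffOn ℝ 1 u (puncDisk x R)) (hw : ContDiffOn ℝ 1 w (puncDisk x R)) (hr : 0 < r)
    (hrR : r < R) {d : ℝ → G}
    (hd : ∀ θ, Real.cos θ • dx u (polarPt x r θ) + Real.sin θ • dy u (polarPt x r θ) +
      (-Real.sin θ • dx w (polarPt x r θ) + Real.cos θ • dy w (polarPt x r θ)) = d θ) :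
    HasDerivAt (circleInt x u) (∫ θ in (-π)..π, d θ) r := by
  have h1 := continuous_comp_polarPt (continuousOn_dx hw) hr hrR
  have h2 := continuous_comp_polarPt (continuousOn_dy hw) hr hrR
  have h3 := continuous_comp_polarPt (continuousOn_dx hu) hr hrR
  have h4 := continuous_comp_polarPt (continuousOn_dy hu) hr hrR
  have key := hasDerivAt_circleInt hu hr hrR
  have h0 := integral_angle_deriv hw hr hrR
  have h5 : ∫ θ in (-π)..π,
      (-Real.sin θ • dx w (polarPt x r θ) + Real.cos θ • dy w (polarPt x r θ)) = 0 := by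
    have : ∀ θ, (-(r * Real.sin θ) • dx w (polarPt x r θ) +
        (r * Real.cos θ) • dy w (polarPt x r θ)) =
        r • (-Real.sin θ • dx w (polarPt x r θ) + Real.cos θ • dy w (polarPt x r θ)) := by
      intro θ; module
    simp_rw [this] at h0
    rw [intervalIntegral.integral_smul] at h0
    exact (smul_eq_zero.1 h0).resolve_left hr.ne'
  convert key using 1
  simp_rw [← hd]
  rw [intervalIntegral.integral_add (Continuous.intervalIntegrable (by fun_prop) _ _)
    (Continuous.intervalIntegrable (by fun_prop) _ _), h5, add_zero]

end Polar

section PolarIntegral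

variable {x : ℝ × ℝ} {R r : ℝ} {u : ℝ × ℝ → ℝ}

lemma circleInt_nonneg (h0 : ∀ z ∈ puncDisk x R, 0 ≤ u z) (hr : 0 < r) (hrR : r < R) :
    0 ≤ circleInt x u r :=
  intervalIntegral.integral_nonneg (by linarith [Real.pi_pos])
    fun θ _ => h0 _ (polarPt_mem hr hrR θ)

lemma circleInt_mono {v : ℝ × ℝ → ℝ} (hu : ContinuousOn u (puncDisk x R))
    (hv : ContinuousOn v (puncDisk x R)) (hr : 0 < r) (hrR : r < R)
    (h : ∀ θ, u (polarPt x r θ) ≤ v (polarPt x r θ)) : circleInt x u r ≤ circleInt x v r :=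
  intervalIntegral.integral_mono (by linarith [Real.pi_pos])
    ((continuous_comp_polarPt hu hr hrR).intervalIntegrable _ _)
    ((continuous_comp_polarPt hv hr hrR).intervalIntegrable _ _) h

/-- Integration in polar coordinates over a punctured disk. -/
lemma lintegral_puncDisk (hR : 0 ≤ R) (hu : ContinuousOn u (puncDisk x R))
    (h0 : ∀ z ∈ puncDisk x R, 0 ≤ u z) :
    ∫⁻ z in puncDisk x R, ENNReal.ofReal (u z) =
      ∫⁻ r in Ioo 0 R, ENNReal.ofReal (r * circleInt x u r) := by
  classical
  set v : ℝ × ℝ → ℝ≥0∞ := (puncDisk x R).indicator fun z => ENNReal.ofReal (u z) with hv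
  have hvm : Measurable v := by
    rw [hv, ← piecewise_eq_indicator]
    exact ContinuousOn.measurable_piecewise (ENNReal.continuous_ofReal.comp_continuousOn hu)
      continuousOn_const isOpen_puncDisk.measurableSet
  have hsymm : ∀ p : ℝ × ℝ, x + polarCoord.symm p = polarPt x p.1 p.2 := fun p => rfl
  have hinner : ∀ r ∈ Ioi (0 : ℝ), ∫⁻ θ in Ioo (-π) π, ENNReal.ofReal r * v (polarPt x r θ) =
      (Iio R).indicator (fun r => ENNReal.ofReal (r * circleInt x u r)) r := by
    intro r hr
    by_cases hrR : r < R
    · have hc := continuous_comp_polarPt hu hr hrR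
      rw [indicator_of_mem (mem_Iio.2 hrR), ENNReal.ofReal_mul (le_of_lt hr),
        lintegral_const_mul' _ _ ENNReal.ofReal_ne_top, circleInt,
        intervalIntegral.integral_of_le (by linarith [Real.pi_pos]),
        ← restrict_Ioo_eq_restrict_Ioc, ofReal_integral_eq_lintegral_ofReal]
      · congr 2 with θ
        rw [hv, indicator_of_mem (polarPt_mem hr hrR θ)]
      · exact (hc.integrableOn_Icc (a := -π) (b := π)).mono_set Ioo_subset_Icc_self
      · exact ae_of_all _ fun θ => h0 _ (polarPt_mem hr hrR θ)
    · rw [indicator_of_notMem (by simpa using hrR)]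
      have : ∀ θ, v (polarPt x r θ) = 0 := fun θ => by
        rw [hv, indicator_of_notMem]
        intro h
        have h2 := h.2
        rw [polarPt_distSq] at h2
        exact hrR (lt_of_pow_lt_pow_left₀ 2 hR h2)
      simp [this]
  calc ∫⁻ z in puncDisk x R, ENNReal.ofReal (u z) = ∫⁻ z, v z :=
        (lintegral_indicator isOpen_puncDisk.measurableSet _).symm
    _ = ∫⁻ z, v (x + z) := (lintegral_add_left_eq_self v x).symm
    _ = ∫⁻ p in Ioi (0 : ℝ) ×ˢ Ioo (-π) π, ENNReal.ofReal p.1 * v (polarPt x p.1 p.2) := by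
        rw [← lintegral_comp_polarCoord_symm]; rfl
    _ = ∫⁻ r in Ioi (0 : ℝ), ∫⁻ θ in Ioo (-π) π, ENNReal.ofReal r * v (polarPt x r θ) := by
        rw [Measure.volume_eq_prod, ← Measure.prod_restrict, lintegral_prod]
        exact (Measurable.mul (by fun_prop) (hvm.comp continuous_polarPt.measurable)).aemeasurable
    _ = ∫⁻ r in Ioi (0 : ℝ), (Iio R).indicator
          (fun r => ENNReal.ofReal (r * circleInt x u r)) r :=
        setLIntegral_congr_fun measurableSet_Ioi hinner
    _ = _ := by
        rw [lintegral_indicator measurableSet_Iio, Measure.restrict_restrict measurableSet_Iio,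
          inter_comm, Ioi_inter_Iio]

lemma continuousOn_mul_circleInt (hu : ContinuousOn u (puncDisk x R)) :
    ContinuousOn (fun t => t * circleInt x u t) (Ioo 0 R) :=
  continuousOn_id.mul (continuousOn_circleInt hu)

lemma integrableOn_mul_circleInt (hR : 0 ≤ R) (hu : ContinuousOn u (puncDisk x R))
    (h0 : ∀ z ∈ puncDisk x R, 0 ≤ u z) (hi : IntegrableOn u (puncDisk x R)) :
    IntegrableOn (fun t => t * circleInt x u t) (Ioo 0 R) := by
  refine ⟨(continuousOn_mul_circleInt hu).aestronglyMeasurable measurableSet_Ioo, ?_⟩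
  rw [hasFiniteIntegral_iff_ofReal, ← lintegral_puncDisk hR hu h0]
  · rw [← hasFiniteIntegral_iff_ofReal]
    · exact hi.2
    · exact (ae_restrict_iff' isOpen_puncDisk.measurableSet).2 (ae_of_all _ h0)
  · exact (ae_restrict_iff' measurableSet_Ioo).2 (ae_of_all _ fun t ht =>
      mul_nonneg ht.1.le (circleInt_nonneg h0 ht.1 ht.2))

lemma integral_puncDisk (hR : 0 ≤ R) (hu : ContinuousOn u (puncDisk x R))
    (h0 : ∀ z ∈ puncDisk x R, 0 ≤ u z) :
    ∫ z in puncDisk x R, u z = ∫ r in Ioo 0 R, r * circleInt x u r := by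
  rw [integral_eq_lintegral_of_nonneg_ae, integral_eq_lintegral_of_nonneg_ae,
    lintegral_puncDisk hR hu h0]
  · exact (ae_restrict_iff' measurableSet_Ioo).2 (ae_of_all _ fun t ht =>
      mul_nonneg ht.1.le (circleInt_nonneg h0 ht.1 ht.2))
  · exact (continuousOn_mul_circleInt hu).aestronglyMeasurable measurableSet_Ioo
  · exact (ae_restrict_iff' isOpen_puncDisk.measurableSet).2 (ae_of_all _ h0)
  · exact hu.aestronglyMeasurable isOpen_puncDisk.measurableSet

/-- If `t e(t)` is integrable near `0` then `t² e(t)` gets arbitrarily small near `0`. -/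
lemma exists_sq_mul_lt {e : ℝ → ℝ} (hR : 0 < R)
    (hi : IntegrableOn (fun t => t * e t) (Ioo 0 R)) {ε : ℝ} (hε : 0 < ε) :
    ∃ t ∈ Ioo 0 R, t ^ 2 * e t < ε := by
  by_contra! h
  have : IntegrableOn (fun t : ℝ => t ^ (-1 : ℝ)) (Ioo 0 R) := by
    refine Integrable.mono' (hi.const_mul ε⁻¹) (Measurable.aestronglyMeasurable (by fun_prop)) ?_
    refine (ae_restrict_iff' measurableSet_Ioo).2 (ae_of_all _ fun t ht => ?_)
    have ht0 : 0 < t := ht.1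
    rw [Real.rpow_neg_one, norm_inv, Real.norm_of_nonneg ht0.le]
    have := h t ht
    field_simp
    nlinarith
  rw [intervalIntegral.integrableOn_Ioo_rpow_iff hR] at this
  norm_num at this

end PolarIntegral

section Flux

variable {x : ℝ × ℝ} {R r : ℝ} {V₁ V₂ : ℝ × ℝ → ℝ}

/-- The outer flux density of the field `(V₁, V₂)` through circles around `x`, with respect to the
angle. -/
def fluxDensity (x : ℝ × ℝ) (V₁ V₂ : ℝ × ℝ → ℝ) (z : ℝ × ℝ) : ℝ :=
  V₁ z * (z.1 - x.1) + V₂ z * (z.2 - x.2)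

lemma contDiffOn_fluxDensity {s : Set (ℝ × ℝ)} (h₁ : ContDiffOn ℝ 1 V₁ s)
    (h₂ : ContDiffOn ℝ 1 V₂ s) : ContDiffOn ℝ 1 (fluxDensity x V₁ V₂) s := by
  unfold fluxDensity
  fun_prop

lemma hasDerivAt_flux (h₁ : ContDiffOn ℝ 1 V₁ (puncDisk x R))
    (h₂ : ContDiffOn ℝ 1 V₂ (puncDisk x R)) (hr : 0 < r) (hrR : r < R) :
    HasDerivAt (circleInt x (fluxDensity x V₁ V₂))
      (r * circleInt x (fun z => dx V₁ z + dy V₂ z) r) r := by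
  have hw : ContDiffOn ℝ 1 (fun z : ℝ × ℝ => V₂ z * (z.1 - x.1) - V₁ z * (z.2 - x.2))
      (puncDisk x R) := by fun_prop
  rw [circleInt, ← intervalIntegral.integral_const_mul]
  refine hasDerivAt_circleInt_of_flux (contDiffOn_fluxDensity h₁ h₂) hw hr hrR fun θ => ?_
  set z := polarPt x r θ with hz
  have d₁ := (differentiableAt_puncDisk h₁ (polarPt_mem hr hrR θ)).hasFDerivAt
  have d₂ := (differentiableAt_puncDisk h₂ (polarPt_mem hr hrR θ)).hasFDerivAt
  rw [← hz] at d₁ d₂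
  have e₁ : HasFDerivAt (fun z : ℝ × ℝ => z.1 - x.1) (ContinuousLinearMap.fst ℝ ℝ ℝ) z :=
    hasFDerivAt_fst.sub_const _
  have e₂ : HasFDerivAt (fun z : ℝ × ℝ => z.2 - x.2) (ContinuousLinearMap.snd ℝ ℝ ℝ) z :=
    hasFDerivAt_snd.sub_const _
  have hu : fderiv ℝ (fluxDensity x V₁ V₂) z = _ := ((d₁.mul e₁).add (d₂.mul e₂)).fderiv
  have hw : fderiv ℝ (fun z : ℝ × ℝ => V₂ z * (z.1 - x.1) - V₁ z * (z.2 - x.2)) z = _ :=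
    ((d₂.mul e₁).sub (d₁.mul e₂)).fderiv
  have hsc := Real.sin_sq_add_cos_sq θ
  have hz1 : z.1 - x.1 = r * Real.cos θ := by simp [hz, polarPt]
  have hz2 : z.2 - x.2 = r * Real.sin θ := by simp [hz, polarPt]
  simp only [dx, dy, hu, hw, hz1, hz2, smul_eq_mul, add_apply, sub_apply, smul_apply,
    ContinuousLinearMap.coe_fst', ContinuousLinearMap.coe_snd']
  linear_combination (r * fderiv ℝ V₁ z (1, 0) + r * fderiv ℝ V₂ z (0, 1)) * hsc

/-- The divergence theorem on a punctured disk as an inequality: a field dominated by a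
square-integrable density has no flux through the puncture. -/
lemma integral_le_flux (hr : 0 < r) (hrR : r < R) (h₁ : ContDiffOn ℝ 1 V₁ (puncDisk x R))
    (h₂ : ContDiffOn ℝ 1 V₂ (puncDisk x R)) {g D : ℝ × ℝ → ℝ} {C : ℝ}
    (hg : ContinuousOn g (puncDisk x R)) (hg0 : ∀ z ∈ puncDisk x R, 0 ≤ g z)
    (hgi : IntegrableOn (fun t => t * circleInt x g t) (Ioo 0 R))
    (hV : ∀ z ∈ puncDisk x r, V₁ z ^ 2 + V₂ z ^ 2 ≤ C * g z)
    (hD : ContinuousOn D (puncDisk x R))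
    (hDi : IntegrableOn (fun t => t * circleInt x D t) (Ioo 0 R))
    (hDV : ∀ z ∈ puncDisk x r, D z ≤ dx V₁ z + dy V₂ z) :
    ∫ t in Ioo 0 r, t * circleInt x D t ≤ circleInt x (fluxDensity x V₁ V₂) r := by
  set Q := circleInt x (fluxDensity x V₁ V₂) with hQ
  have hQc : ContinuousOn Q (Ioo 0 R) :=
    continuousOn_circleInt (contDiffOn_fluxDensity h₁ h₂).continuousOn
  have hdiv : ContinuousOn (fun z => dx V₁ z + dy V₂ z) (puncDisk x R) :=
    (continuousOn_dx h₁).add (continuousOn_dy h₂)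
  have hDi' : IntegrableOn (fun t => t * circleInt x D t) (Icc 0 r) := by
    rw [integrableOn_Icc_iff_integrableOn_Ioo]
    exact hDi.mono_set (Ioo_subset_Ioo_right hrR.le)
  have step : ∀ a ∈ Ioo 0 r, ∫ t in a..r, t * circleInt x D t ≤ Q r - Q a := by
    intro a ha
    refine intervalIntegral.integral_le_sub_of_hasDeriv_right_of_le ha.2.le
      (hQc.mono fun t ht => ⟨ha.1.trans_le ht.1, ht.2.trans_lt hrR⟩)
      (fun t ht => (hasDerivAt_flux h₁ h₂ (ha.1.trans ht.1) (ht.2.trans hrR)).hasDerivWithinAt)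
      (hDi'.mono_set (Icc_subset_Icc_left ha.1.le)) fun t ht => ?_
    have ht0 : 0 < t := ha.1.trans ht.1
    exact mul_le_mul_of_nonneg_left (circleInt_mono hD hdiv ht0 (ht.2.trans hrR) fun θ =>
      hDV _ (polarPt_mem ht0 ht.2 θ)) ht0.le
  have small : ∀ ε > 0, ∀ b ∈ Ioc 0 r, ∃ a ∈ Ioo 0 b, -Q a ≤ ε := by
    intro ε hε b hb
    set δ := ε / (2 * π) with hδ
    have hδ0 : 0 < δ := by positivity
    obtain ⟨a, ha, hsmall⟩ := exists_sq_mul_lt (e := circleInt x g) hb.1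
      (hgi.mono_set (Ioo_subset_Ioo_right (hb.2.trans hrR.le)))
      (ε := ε * δ / (|C| + 1)) (by positivity)
    refine ⟨a, ha, ?_⟩
    have ha0 : 0 < a := ha.1
    have har : a < r := ha.2.trans_le hb.2
    have haR := har.trans hrR
    have hcg : Continuous fun θ => g (polarPt x a θ) := continuous_comp_polarPt hg ha0 haR
    have hcg' : Continuous fun θ => C * g (polarPt x a θ) := continuous_const.mul hcg
    have hcg'' : Continuous fun θ => a ^ 2 / (2 * δ) * (C * g (polarPt x a θ)) :=
      continuous_const.mul hcg'
    have hcQ : Continuous fun θ => fluxDensity x V₁ V₂ (polarPt x a θ) :=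
      continuous_comp_polarPt (contDiffOn_fluxDensity h₁ h₂).continuousOn ha0 haR
    have hCg : circleInt x (fun z => C * g z) a = C * circleInt x g a := by
      simp [circleInt]
    have hpt : ∀ θ, -fluxDensity x V₁ V₂ (polarPt x a θ) ≤
        δ / 2 + a ^ 2 / (2 * δ) * (C * g (polarPt x a θ)) := by
      intro θ
      have h1 := hV _ (polarPt_mem ha0 har θ)
      have h2 : fluxDensity x V₁ V₂ (polarPt x a θ) = a * (V₁ (polarPt x a θ) * Real.cos θ +
          V₂ (polarPt x a θ) * Real.sin θ) := by simp [fluxDensity, polarPt]; ring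
      set v₁ := V₁ (polarPt x a θ)
      set v₂ := V₂ (polarPt x a θ)
      have hsc := Real.sin_sq_add_cos_sq θ
      have h3 : (v₁ * Real.cos θ + v₂ * Real.sin θ) ^ 2 ≤ v₁ ^ 2 + v₂ ^ 2 := by
        have : v₁ ^ 2 + v₂ ^ 2 - (v₁ * Real.cos θ + v₂ * Real.sin θ) ^ 2 =
            (v₁ * Real.sin θ - v₂ * Real.cos θ) ^ 2 := by
          linear_combination -(v₁ ^ 2 + v₂ ^ 2) * hsc
        nlinarith [sq_nonneg (v₁ * Real.sin θ - v₂ * Real.cos θ)]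
      rw [h2]
      set q := v₁ * Real.cos θ + v₂ * Real.sin θ
      have h4 : a ^ 2 / (2 * δ) * q ^ 2 ≤ a ^ 2 / (2 * δ) * (C * g (polarPt x a θ)) :=
        mul_le_mul_of_nonneg_left (h3.trans h1) (by positivity)
      have h5 : 0 ≤ δ / 2 + a ^ 2 / (2 * δ) * q ^ 2 + a * q := by
        have : δ / 2 + a ^ 2 / (2 * δ) * q ^ 2 + a * q = (δ + a * q) ^ 2 / (2 * δ) := by
          field_simp; ring
        rw [this]; positivity
      linarith
    calc -Q a = ∫ θ in (-π)..π, -fluxDensity x V₁ V₂ (polarPt x a θ) := by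
          rw [intervalIntegral.integral_neg]; rfl
      _ ≤ ∫ θ in (-π)..π, (δ / 2 + a ^ 2 / (2 * δ) * (C * g (polarPt x a θ))) :=
          intervalIntegral.integral_mono (by linarith [Real.pi_pos])
            (hcQ.neg.intervalIntegrable _ _)
            ((continuous_const.add hcg'').intervalIntegrable _ _) hpt
      _ = π * δ + C * (a ^ 2 * circleInt x g a) / (2 * δ) := by
          rw [intervalIntegral.integral_add (Continuous.intervalIntegrable (by fun_prop) _ _)
            (hcg''.intervalIntegrable _ _),
            intervalIntegral.integral_const_mul]
          have : ∫ θ in (-π)..π, C * g (polarPt x a θ) = C * circleInt x g a := hCg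
          rw [this, intervalIntegral.integral_const, smul_eq_mul]
          ring
      _ ≤ ε / 2 + ε / 2 := by
          refine add_le_add (le_of_eq (by rw [hδ]; field_simp)) ?_
          rw [div_le_iff₀ (by positivity)]
          have h6 : C * (a ^ 2 * circleInt x g a) ≤ ε * δ := by
            rw [lt_div_iff₀ (by positivity)] at hsmall
            have h7 := circleInt_nonneg hg0 ha0 haR
            have : C * (a ^ 2 * circleInt x g a) ≤ (|C| + 1) * (a ^ 2 * circleInt x g a) :=
              mul_le_mul_of_nonneg_right (by linarith [le_abs_self C]) (by positivity)
            linarith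
          linarith
      _ = ε := by ring
  refine le_of_forall_pos_le_add fun η hη => ?_
  have hcont : ContinuousOn (fun b => ∫ t in (0:ℝ)..b, t * circleInt x D t) (uIcc 0 r) :=
    intervalIntegral.continuousOn_primitive_interval (by rwa [uIcc_of_le hr.le])
  have h0 := hcont 0 left_mem_uIcc
  rw [Metric.continuousWithinAt_iff] at h0
  obtain ⟨b, hb, hb'⟩ := h0 (η / 2) (by positivity)
  obtain ⟨a, ha, haQ⟩ := small (η / 2) (by positivity) (min b r) ⟨lt_min hb hr, min_le_right _ _⟩
  have ha0 : 0 < a := ha.1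
  have har : a < r := ha.2.trans_le (min_le_right _ _)
  have h1 := hb' (x := a) (by rw [uIcc_of_le hr.le]; exact ⟨ha0.le, har.le⟩)
    (by rw [Real.dist_eq, sub_zero, abs_of_pos ha0]; exact ha.2.trans_le (min_le_left _ _))
  rw [intervalIntegral.integral_same, Real.dist_eq, sub_zero] at h1
  have h2 := step a ⟨ha0, har⟩
  have h3 : ∫ t in Ioo 0 r, t * circleInt x D t = (∫ t in (0:ℝ)..a, t * circleInt x D t) +
      ∫ t in a..r, t * circleInt x D t := by
    rw [← integral_Ioc_eq_integral_Ioo, ← intervalIntegral.integral_of_le hr.le,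
      intervalIntegral.integral_add_adjacent_intervals]
    · rw [intervalIntegrable_iff_integrableOn_Icc_of_le ha0.le]
      exact hDi'.mono_set (Icc_subset_Icc_right har.le)
    · rw [intervalIntegrable_iff_integrableOn_Icc_of_le har.le]
      exact hDi'.mono_set (Icc_subset_Icc_left ha0.le)
  rw [h3]
  linarith [le_abs_self (∫ t in (0:ℝ)..a, t * circleInt x D t)]

end Flux

section Algebra

variable {F : Type*} [NormedAddCommGroup F] [InnerProductSpace ℝ F]

/-- Only the part of `X` normal to the conformal frame `a, b` pairs with a normal vector `L`. -/
lemma inner_sq_le_of_conformal {a b L X : F} (hn : ‖a‖ ^ 2 = ‖b‖ ^ 2) (hab : ⟪a, b⟫ = 0)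
    (hLa : ⟪L, a⟫ = 0) (hLb : ⟪L, b⟫ = 0) (hpos : 0 < ‖a‖ ^ 2 + ‖b‖ ^ 2) :
    (‖a‖ ^ 2 + ‖b‖ ^ 2) * ⟪X, L⟫ ^ 2 ≤ ‖L‖ ^ 2 *
      (‖X‖ ^ 2 * (‖a‖ ^ 2 + ‖b‖ ^ 2) - 2 * (⟪X, a⟫ ^ 2 + ⟪X, b⟫ ^ 2)) := by
  set l := ‖a‖ ^ 2 with hl
  have hl0 : 0 < l := by linarith
  have hb : ⟪b, b⟫ = l := by rw [real_inner_self_eq_norm_sq, hn]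
  have ha : ⟪a, a⟫ = l := by rw [real_inner_self_eq_norm_sq]
  set Y := l • X - ⟪X, a⟫ • a - ⟪X, b⟫ • b with hY
  have h1 : ⟪Y, L⟫ = l * ⟪X, L⟫ := by
    rw [hY, inner_sub_left, inner_sub_left, inner_smul_left, inner_smul_left, inner_smul_left,
      real_inner_comm L a, real_inner_comm L b, hLa, hLb]
    simp
  have h2 : ‖Y‖ ^ 2 = l * (l * ‖X‖ ^ 2 - (⟪X, a⟫ ^ 2 + ⟪X, b⟫ ^ 2)) := by
    rw [← real_inner_self_eq_norm_sq, ← real_inner_self_eq_norm_sq X, hY]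
    simp only [inner_sub_left, inner_sub_right, inner_smul_left, inner_smul_right, ha, hb, hab,
      real_inner_comm X a, real_inner_comm X b, real_inner_comm a b, conj_trivial]
    ring
  have h3 : ⟪Y, L⟫ ^ 2 ≤ ‖Y‖ ^ 2 * ‖L‖ ^ 2 := by
    rw [← mul_pow, ← sq_abs ⟪Y, L⟫]
    exact pow_le_pow_left₀ (abs_nonneg _) (abs_real_inner_le_norm Y L) 2
  rw [h1, h2] at h3
  rw [← hn]
  have h4 : l * (l * ⟪X, L⟫ ^ 2) ≤
      l * ((l * ‖X‖ ^ 2 - (⟪X, a⟫ ^ 2 + ⟪X, b⟫ ^ 2)) * ‖L‖ ^ 2) := by linarith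
  have := le_of_mul_le_mul_left h4 hl0
  linarith

/-- The pointwise inequality behind Simon's monotonicity formula. -/
lemma monotonicity_pointwise {a b L X : F} (hn : ‖a‖ ^ 2 = ‖b‖ ^ 2) (hab : ⟪a, b⟫ = 0)
    (hLa : ⟪L, a⟫ = 0) (hLb : ⟪L, b⟫ = 0) (hpos : 0 < ‖a‖ ^ 2 + ‖b‖ ^ 2) {s φ : ℝ}
    (hφ : φ * (‖X‖ ^ 2 + s) = 1) :
    s * φ ^ 2 * (‖a‖ ^ 2 + ‖b‖ ^ 2) - ‖L‖ ^ 2 / (‖a‖ ^ 2 + ‖b‖ ^ 2) / 4 ≤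
      φ * (‖a‖ ^ 2 + ‖b‖ ^ 2) + φ * ⟪X, L⟫ - 2 * φ ^ 2 * (⟪X, a⟫ ^ 2 + ⟪X, b⟫ ^ 2) := by
  have key := inner_sq_le_of_conformal (X := X) hn hab hLa hLb hpos
  set g := ‖a‖ ^ 2 + ‖b‖ ^ 2 with hg
  set N := ‖X‖ ^ 2 * g - 2 * (⟪X, a⟫ ^ 2 + ⟪X, b⟫ ^ 2) with hN
  have h1 : φ * g = φ ^ 2 * (‖X‖ ^ 2 + s) * g := by linear_combination -φ * g * hφ
  have hN0 : 0 ≤ N := by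
    have h2 : ∀ c : F, ⟪X, c⟫ ^ 2 ≤ ‖X‖ ^ 2 * ‖c‖ ^ 2 := fun c => by
      rw [← mul_pow, ← sq_abs ⟪X, c⟫]
      exact pow_le_pow_left₀ (abs_nonneg _) (abs_real_inner_le_norm X c) 2
    have h3 := inner_sq_le_of_conformal (L := (0 : F)) (X := X) hn hab (by simp) (by simp) hpos
    set l := ‖a‖ ^ 2 with hl
    have hl0 : 0 < l := by linarith
    have hb : ⟪b, b⟫ = l := by rw [real_inner_self_eq_norm_sq, hn]
    have ha : ⟪a, a⟫ = l := by rw [real_inner_self_eq_norm_sq]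
    have h4 : ‖l • X - ⟪X, a⟫ • a - ⟪X, b⟫ • b‖ ^ 2 =
        l * (l * ‖X‖ ^ 2 - (⟪X, a⟫ ^ 2 + ⟪X, b⟫ ^ 2)) := by
      rw [← real_inner_self_eq_norm_sq, ← real_inner_self_eq_norm_sq X]
      simp only [inner_sub_left, inner_sub_right, inner_smul_left, inner_smul_right, ha, hb, hab,
        real_inner_comm X a, real_inner_comm X b, real_inner_comm a b, conj_trivial]
      ring
    have h5 : 0 ≤ l * ‖X‖ ^ 2 - (⟪X, a⟫ ^ 2 + ⟪X, b⟫ ^ 2) :=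
      nonneg_of_mul_nonneg_right (h4 ▸ sq_nonneg _) hl0
    rw [hN, hg, ← hn]
    linarith
  have h6 : (4 * g * (φ * ⟪X, L⟫)) ^ 2 ≤ (4 * g * (φ ^ 2 * N) + ‖L‖ ^ 2) ^ 2 := by
    have : 16 * g * φ ^ 2 * (g * ⟪X, L⟫ ^ 2) ≤ 16 * g * φ ^ 2 * (‖L‖ ^ 2 * N) :=
      mul_le_mul_of_nonneg_left key (by positivity)
    nlinarith [sq_nonneg (4 * g * (φ ^ 2 * N) - ‖L‖ ^ 2)]
  have h7 := neg_le_of_abs_le (abs_le_of_sq_le_sq h6 (by positivity))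
  have h8 : φ * g + φ * ⟪X, L⟫ - 2 * φ ^ 2 * (⟪X, a⟫ ^ 2 + ⟪X, b⟫ ^ 2) -
      (s * φ ^ 2 * g - ‖L‖ ^ 2 / g / 4) =
      (4 * g * (φ * ⟪X, L⟫) + (4 * g * (φ ^ 2 * N) + ‖L‖ ^ 2)) / (4 * g) := by
    rw [h1, hN]
    field_simp
    ring
  have h9 : 0 ≤ (4 * g * (φ * ⟪X, L⟫) + (4 * g * (φ ^ 2 * N) + ‖L‖ ^ 2)) / (4 * g) :=
    div_nonneg (by linarith) (by positivity)
  linarith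

end Algebra

section Conformal

variable {F : Type*} [NormedAddCommGroup F] [InnerProductSpace ℝ F]

/-- `f` is a conformal immersion of the punctured disk of radius `R` around `x`, of finite energy
and finite Willmore energy. -/
structure IsConformalPuncture (f : ℝ × ℝ → F) (x : ℝ × ℝ) (R : ℝ) : Prop where
  pos : 0 < R
  smooth : ContDiffOn ℝ 2 f (puncDisk x R)
  norm_eq : ∀ z ∈ puncDisk x R, ‖dx f z‖ ^ 2 = ‖dy f z‖ ^ 2
  inner_eq : ∀ z ∈ puncDisk x R, ⟪dx f z, dy f z⟫ = 0
  energy_pos : ∀ z ∈ puncDisk x R, 0 < energyDensity f z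
  energy_int : IntegrableOn (energyDensity f) (puncDisk x R)
  willmore_int : IntegrableOn (willmoreDensity f) (puncDisk x R)

variable {f : ℝ × ℝ → F} {x : ℝ × ℝ} {R r : ℝ}

section Basic

variable {s : Set (ℝ × ℝ)} {z : ℝ × ℝ}

lemma contDiffOn_dx (hs : IsOpen s) (hf : ContDiffOn ℝ 2 f s) : ContDiffOn ℝ 1 (dx f) s :=
  (hf.fderiv_of_isOpen hs (by norm_num)).clm_apply contDiffOn_const

lemma contDiffOn_dy (hs : IsOpen s) (hf : ContDiffOn ℝ 2 f s) : ContDiffOn ℝ 1 (dy f) s :=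
  (hf.fderiv_of_isOpen hs (by norm_num)).clm_apply contDiffOn_const

lemma continuousOn_laplace (hs : IsOpen s) (hf : ContDiffOn ℝ 2 f s) :
    ContinuousOn (laplace f) s :=
  (((contDiffOn_dx hs hf).continuousOn_fderiv_of_isOpen hs le_rfl).clm_apply
    continuousOn_const).add
  (((contDiffOn_dy hs hf).continuousOn_fderiv_of_isOpen hs le_rfl).clm_apply continuousOn_const)

lemma continuousOn_energyDensity (hs : IsOpen s) (hf : ContDiffOn ℝ 2 f s) :
    ContinuousOn (energyDensity f) s :=
  ((contDiffOn_dx hs hf).continuousOn.norm.pow 2).add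
    ((contDiffOn_dy hs hf).continuousOn.norm.pow 2)

lemma dx_dy_comm (hs : IsOpen s) (hf : ContDiffOn ℝ 2 f s) (hz : z ∈ s) :
    dx (dy f) z = dy (dx f) z := by
  have hd : DifferentiableAt ℝ (fderiv ℝ f) z :=
    ((hf.fderiv_of_isOpen hs (m := 1) (by norm_num)).differentiableOn one_ne_zero).differentiableAt
      (hs.mem_nhds hz)
  have hsymm : IsSymmSndFDerivAt ℝ f z :=
    (hf.contDiffAt (hs.mem_nhds hz)).isSymmSndFDerivAt (by simp)
  have h1 : ∀ v : ℝ × ℝ, fderiv ℝ (fun w => fderiv ℝ f w v) z =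
      (fderiv ℝ (fderiv ℝ f) z).flip v := fun v => by
    rw [fderiv_clm_apply hd (differentiableAt_const v)]
    simp
  change fderiv ℝ (fun w => fderiv ℝ f w (0, 1)) z (1, 0) =
    fderiv ℝ (fun w => fderiv ℝ f w (1, 0)) z (0, 1)
  rw [h1, h1, ContinuousLinearMap.flip_apply, ContinuousLinearMap.flip_apply]
  exact hsymm _ _

end Basic

lemma willmoreDensity_nonneg (f : ℝ × ℝ → F) (z : ℝ × ℝ) : 0 ≤ willmoreDensity f z := by
  unfold willmoreDensity energyDensity; positivity

lemma energyDensity_nonneg (f : ℝ × ℝ → F) (z : ℝ × ℝ) : 0 ≤ energyDensity f z := by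
  unfold energyDensity; positivity

/-- The directional derivative of an inner product. -/
lemma fderiv_inner_apply' {u v : ℝ × ℝ → F} {z : ℝ × ℝ} (hu : DifferentiableAt ℝ u z)
    (hv : DifferentiableAt ℝ v z) (e : ℝ × ℝ) :
    fderiv ℝ (fun w => ⟪u w, v w⟫) z e = ⟪u z, fderiv ℝ v z e⟫ + ⟪fderiv ℝ u z e, v z⟫ :=
  fderiv_inner_apply ℝ hu hv e

/-- The Laplacian of a weakly conformal map is normal. -/
lemma laplace_normal {s : Set (ℝ × ℝ)} (hs : IsOpen s) (hf : ContDiffOn ℝ 2 f s)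
    (hn : ∀ z ∈ s, ‖dx f z‖ ^ 2 = ‖dy f z‖ ^ 2) (hi : ∀ z ∈ s, ⟪dx f z, dy f z⟫ = 0)
    {z : ℝ × ℝ} (hz : z ∈ s) : ⟪laplace f z, dx f z⟫ = 0 ∧ ⟪laplace f z, dy f z⟫ = 0 := by
  have d1 : DifferentiableAt ℝ (dx f) z :=
    ((contDiffOn_dx hs hf).differentiableOn one_ne_zero).differentiableAt (hs.mem_nhds hz)
  have d2 : DifferentiableAt ℝ (dy f) z :=
    ((contDiffOn_dy hs hf).differentiableOn one_ne_zero).differentiableAt (hs.mem_nhds hz)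
  have h1 : ∀ e, ⟪dx f z, fderiv ℝ (dx f) z e⟫ = ⟪dy f z, fderiv ℝ (dy f) z e⟫ := by
    intro e
    have heq : (fun w => ⟪dx f w, dx f w⟫) =ᶠ[𝓝 z] fun w => ⟪dy f w, dy f w⟫ := by
      filter_upwards [hs.mem_nhds hz] with w hw
      rw [real_inner_self_eq_norm_sq, real_inner_self_eq_norm_sq, hn w hw]
    have := congrArg (fun T : (ℝ × ℝ) →L[ℝ] ℝ => T e) heq.fderiv_eq
    simp only [fderiv_inner_apply' d1 d1, fderiv_inner_apply' d2 d2] at this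
    rw [real_inner_comm (dx f z) (fderiv ℝ (dx f) z e),
      real_inner_comm (dy f z) (fderiv ℝ (dy f) z e)] at this
    linarith
  have h2 : ∀ e, ⟪dx f z, fderiv ℝ (dy f) z e⟫ + ⟪fderiv ℝ (dx f) z e, dy f z⟫ = 0 := by
    intro e
    have heq : (fun w => ⟪dx f w, dy f w⟫) =ᶠ[𝓝 z] fun _ => (0 : ℝ) := by
      filter_upwards [hs.mem_nhds hz] with w hw using hi w hw
    have := congrArg (fun T : (ℝ × ℝ) →L[ℝ] ℝ => T e) heq.fderiv_eq
    simpa [fderiv_inner_apply' d1 d2] using this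
  have hc : fderiv ℝ (dy f) z (1, 0) = fderiv ℝ (dx f) z (0, 1) := dx_dy_comm hs hf hz
  have h11 := h1 (1, 0)
  have h12 := h1 (0, 1)
  have h21 := h2 (1, 0)
  have h22 := h2 (0, 1)
  rw [hc] at h11 h21
  have e1 : laplace f z = fderiv ℝ (dx f) z (1, 0) + fderiv ℝ (dy f) z (0, 1) := rfl
  rw [e1, inner_add_left, inner_add_left]
  constructor
  · rw [real_inner_comm (dx f z), real_inner_comm (dx f z) (fderiv ℝ (dy f) z (0, 1))]
    rw [real_inner_comm (dy f z) (fderiv ℝ (dx f) z (0, 1))] at h22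
    linarith
  · rw [real_inner_comm (dy f z) (fderiv ℝ (dy f) z (0, 1))]
    linarith

namespace IsConformalPuncture

variable (hf : IsConformalPuncture f x R)
include hf

lemma mono {r : ℝ} (hr : 0 < r) (hrR : r ≤ R) : IsConformalPuncture f x r := by
  have hs : puncDisk x r ⊆ puncDisk x R := puncDisk_mono hr.le hrR
  exact ⟨hr, hf.smooth.mono hs, fun z hz => hf.norm_eq z (hs hz), fun z hz => hf.inner_eq z (hs hz),
    fun z hz => hf.energy_pos z (hs hz), hf.energy_int.mono_set hs, hf.willmore_int.mono_set hs⟩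

lemma contDiffOn_dx : ContDiffOn ℝ 1 (dx f) (puncDisk x R) :=
  PuncturedDisk.contDiffOn_dx isOpen_puncDisk hf.smooth

lemma contDiffOn_dy : ContDiffOn ℝ 1 (dy f) (puncDisk x R) :=
  PuncturedDisk.contDiffOn_dy isOpen_puncDisk hf.smooth

lemma continuousOn_energyDensity : ContinuousOn (energyDensity f) (puncDisk x R) :=
  PuncturedDisk.continuousOn_energyDensity isOpen_puncDisk hf.smooth

lemma continuousOn_willmoreDensity : ContinuousOn (willmoreDensity f) (puncDisk x R) :=
  ((continuousOn_laplace isOpen_puncDisk hf.smooth).norm.pow 2).div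
    hf.continuousOn_energyDensity fun z hz => (hf.energy_pos z hz).ne'

lemma energy_circle_int :
    IntegrableOn (fun t => t * circleInt x (energyDensity f) t) (Ioo 0 R) :=
  integrableOn_mul_circleInt hf.pos.le hf.continuousOn_energyDensity
    (fun z _ => energyDensity_nonneg f z) hf.energy_int

lemma willmore_circle_int :
    IntegrableOn (fun t => t * circleInt x (willmoreDensity f) t) (Ioo 0 R) :=
  integrableOn_mul_circleInt hf.pos.le hf.continuousOn_willmoreDensity
    (fun z _ => willmoreDensity_nonneg f z) hf.willmore_int

/-- The divergence of the field `φ · ⟨f - p, ∇f⟩`. -/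
lemma div_field {φ : ℝ × ℝ → ℝ} (hφ : ContDiffOn ℝ 1 φ (puncDisk x R)) (p : F) {z : ℝ × ℝ}
    (hz : z ∈ puncDisk x R) :
    dx (fun w => φ w * ⟪f w - p, dx f w⟫) z + dy (fun w => φ w * ⟪f w - p, dy f w⟫) z =
      φ z * energyDensity f z + φ z * ⟪f z - p, laplace f z⟫ +
      (dx φ z * ⟪f z - p, dx f z⟫ + dy φ z * ⟪f z - p, dy f z⟫) := by
  have d0 : DifferentiableAt ℝ (fun w => f w - p) z :=
    (differentiableAt_puncDisk (hf.smooth.of_le (by norm_num)) hz).sub_const p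
  have d1 := differentiableAt_puncDisk hf.contDiffOn_dx hz
  have d2 := differentiableAt_puncDisk hf.contDiffOn_dy hz
  have dφ := differentiableAt_puncDisk hφ hz
  have e1 : fderiv ℝ (fun w => φ w * ⟪f w - p, dx f w⟫) z = _ :=
    fderiv_fun_mul dφ (d0.inner ℝ d1)
  have e2 : fderiv ℝ (fun w => φ w * ⟪f w - p, dy f w⟫) z = _ :=
    fderiv_fun_mul dφ (d0.inner ℝ d2)
  have e0 : fderiv ℝ (fun w => f w - p) z = fderiv ℝ f z := fderiv_sub_const p
  have h11 : fderiv ℝ f z (1, 0) = dx f z := rfl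
  have h12 : fderiv ℝ f z (0, 1) = dy f z := rfl
  rw [dx, dy, e1, e2]
  simp only [add_apply, smul_apply, smul_eq_mul, fderiv_inner_apply' d0 d1,
    fderiv_inner_apply' d0 d2, e0, laplace, inner_add_right, energyDensity, h11, h12,
    real_inner_self_eq_norm_sq]
  simp only [dx, dy]
  ring

end IsConformalPuncture

end Conformal

section

section CircleAlgebra

variable {u v : ℝ × ℝ → ℝ} {x : ℝ × ℝ} {R r : ℝ}

lemma circleInt_sub_const_mul (hu : ContinuousOn u (puncDisk x R))
    (hv : ContinuousOn v (puncDisk x R)) (c : ℝ) {t : ℝ} (ht : t ∈ Ioo 0 R) :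
    t * circleInt x (fun z => u z - c * v z) t =
      t * circleInt x u t - c * (t * circleInt x v t) := by
  have h := intervalIntegral.integral_sub (μ := volume) (a := -π) (b := π)
    ((continuous_comp_polarPt hu ht.1 ht.2).intervalIntegrable _ _)
    (((continuous_comp_polarPt hv ht.1 ht.2).intervalIntegrable _ _).const_mul c)
  rw [intervalIntegral.integral_const_mul] at h
  unfold circleInt
  rw [h]
  ring

lemma integrableOn_mul_circleInt_sub (hu : ContinuousOn u (puncDisk x R))
    (hv : ContinuousOn v (puncDisk x R)) (c : ℝ)
    (hui : IntegrableOn (fun t => t * circleInt x u t) (Ioo 0 R))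
    (hvi : IntegrableOn (fun t => t * circleInt x v t) (Ioo 0 R)) :
    IntegrableOn (fun t => t * circleInt x (fun z => u z - c * v z) t) (Ioo 0 R) :=
  IntegrableOn.congr_fun (hui.sub (hvi.const_mul c))
    (fun _ ht => (circleInt_sub_const_mul hu hv c ht).symm) measurableSet_Ioo

lemma integral_mul_circleInt_sub (hu : ContinuousOn u (puncDisk x R))
    (hv : ContinuousOn v (puncDisk x R)) (c : ℝ)
    (hui : IntegrableOn (fun t => t * circleInt x u t) (Ioo 0 R))
    (hvi : IntegrableOn (fun t => t * circleInt x v t) (Ioo 0 R)) (hrR : r ≤ R) :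
    ∫ t in Ioo 0 r, t * circleInt x (fun z => u z - c * v z) t =
      (∫ t in Ioo 0 r, t * circleInt x u t) - c * ∫ t in Ioo 0 r, t * circleInt x v t := by
  have hs : Ioo 0 r ⊆ Ioo 0 R := Ioo_subset_Ioo_right hrR
  rw [← integral_const_mul, ← integral_sub (hui.mono_set hs) ((hvi.mono_set hs).const_mul c)]
  exact setIntegral_congr_fun measurableSet_Ioo
    fun t ht => circleInt_sub_const_mul hu hv c (hs ht)

lemma fluxDensity_polarPt_sq_le (V₁ V₂ : ℝ × ℝ → ℝ) (r θ : ℝ) :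
    fluxDensity x V₁ V₂ (polarPt x r θ) ^ 2 ≤
      r ^ 2 * (V₁ (polarPt x r θ) ^ 2 + V₂ (polarPt x r θ) ^ 2) := by
  rw [← polarPt_distSq x r θ, fluxDensity]
  set z := polarPt x r θ
  nlinarith [sq_nonneg (V₁ z * (z.2 - x.2) - V₂ z * (z.1 - x.1))]

end CircleAlgebra

variable {F : Type*} [NormedAddCommGroup F] [InnerProductSpace ℝ F]

lemma inner_sq_add_inner_sq_le (X a b : F) :
    ⟪X, a⟫ ^ 2 + ⟪X, b⟫ ^ 2 ≤ ‖X‖ ^ 2 * (‖a‖ ^ 2 + ‖b‖ ^ 2) := by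
  have h2 : ∀ c : F, ⟪X, c⟫ ^ 2 ≤ ‖X‖ ^ 2 * ‖c‖ ^ 2 := fun c => by
    rw [← mul_pow, ← sq_abs ⟪X, c⟫]
    exact pow_le_pow_left₀ (abs_nonneg _) (abs_real_inner_le_norm X c) 2
  linarith [h2 a, h2 b]

variable {f : ℝ × ℝ → F} {x : ℝ × ℝ} {R r : ℝ}

/-- The cut-off `1 / (|f - p|² + s)` used in the monotonicity formula. -/
noncomputable def simonWeight (f : ℝ × ℝ → F) (p : F) (s : ℝ) (z : ℝ × ℝ) : ℝ :=
  (‖f z - p‖ ^ 2 + s)⁻¹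

omit [InnerProductSpace ℝ F] in
lemma simonWeight_mul {s : ℝ} (hs : 0 < s) (p : F) (z : ℝ × ℝ) :
    simonWeight f p s z * (‖f z - p‖ ^ 2 + s) = 1 :=
  inv_mul_cancel₀ (by positivity)

omit [InnerProductSpace ℝ F] in
lemma simonWeight_pos {s : ℝ} (hs : 0 < s) (p : F) (z : ℝ × ℝ) : 0 < simonWeight f p s z := by
  unfold simonWeight; positivity

omit [InnerProductSpace ℝ F] in
lemma simonWeight_sq_le {s : ℝ} (hs : 0 < s) (p : F) (z : ℝ × ℝ) :
    simonWeight f p s z ^ 2 * ‖f z - p‖ ^ 2 ≤ 1 / s := by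
  have h := simonWeight_mul (f := f) hs p z
  have h0 := simonWeight_pos (f := f) hs p z
  set w := simonWeight f p s z
  have h1 : w * s ≤ 1 := by nlinarith [mul_nonneg h0.le (sq_nonneg ‖f z - p‖)]
  have h2 : w * ‖f z - p‖ ^ 2 ≤ 1 := by nlinarith [mul_pos h0 hs]
  rw [le_div_iff₀ hs]
  calc w ^ 2 * ‖f z - p‖ ^ 2 * s = (w * s) * (w * ‖f z - p‖ ^ 2) := by ring
    _ ≤ 1 * 1 := mul_le_mul h1 h2 (by positivity) zero_le_one
    _ = 1 := one_mul 1

omit [InnerProductSpace ℝ F] in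
lemma simonWeight_sq_mul_le_inv {s d : ℝ} (hs : 0 < s) (hd : 0 < d) {p : F} {z : ℝ × ℝ}
    (h : d ≤ ‖f z - p‖) : simonWeight f p s z ^ 2 * ‖f z - p‖ ^ 2 ≤ 1 / d ^ 2 := by
  have h1 := simonWeight_mul (f := f) hs p z
  have h0 := simonWeight_pos (f := f) hs p z
  set w := simonWeight f p s z
  have h2 : w * ‖f z - p‖ ^ 2 ≤ 1 := by nlinarith [mul_pos h0 hs]
  have h3 : w * d ^ 2 ≤ 1 := le_trans (by gcongr) h2
  rw [le_div_iff₀ (by positivity)]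
  calc w ^ 2 * ‖f z - p‖ ^ 2 * d ^ 2 = (w * d ^ 2) * (w * ‖f z - p‖ ^ 2) := by ring
    _ ≤ 1 * 1 := mul_le_mul h3 h2 (by positivity) zero_le_one
    _ = 1 := one_mul 1

lemma contDiffOn_simonWeight {A : Set (ℝ × ℝ)} (hf : ContDiffOn ℝ 1 f A) {s : ℝ} (hs : 0 < s)
    (p : F) : ContDiffOn ℝ 1 (simonWeight f p s) A :=
  (((hf.sub contDiffOn_const).norm_sq ℝ).add contDiffOn_const).inv fun z _ => by positivity

lemma fderiv_simonWeight {z : ℝ × ℝ} (hf : DifferentiableAt ℝ f z) {s : ℝ} (hs : 0 < s)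
    (p : F) (e : ℝ × ℝ) : fderiv ℝ (simonWeight f p s) z e =
      -(simonWeight f p s z ^ 2 * (2 * ⟪f z - p, fderiv ℝ f z e⟫)) := by
  have h1 : HasFDerivAt (fun w => ‖f w - p‖ ^ 2 + s) _ z :=
    ((hf.hasFDerivAt.sub_const p).norm_sq).add_const s
  have h2 := (hasDerivAt_inv (x := ‖f z - p‖ ^ 2 + s) (by positivity)).comp_hasFDerivAt z h1
  have h3 : HasFDerivAt (simonWeight f p s) _ z := h2
  rw [h3.fderiv]
  simp [simonWeight, inner_sub_left]

lemma field_sq_le (φ : ℝ) (p : F) (z : ℝ × ℝ) :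
    (φ * ⟪f z - p, dx f z⟫) ^ 2 + (φ * ⟪f z - p, dy f z⟫) ^ 2 ≤
      φ ^ 2 * ‖f z - p‖ ^ 2 * energyDensity f z := by
  have := mul_le_mul_of_nonneg_left
    (inner_sq_add_inner_sq_le (f z - p) (dx f z) (dy f z)) (sq_nonneg φ)
  rw [energyDensity]
  linarith

namespace IsConformalPuncture

variable (hf : IsConformalPuncture f x R)
include hf

lemma contDiffOn_field {φ : ℝ × ℝ → ℝ} (hφ : ContDiffOn ℝ 1 φ (puncDisk x R)) (p : F) :
    ContDiffOn ℝ 1 (fun w => φ w * ⟪f w - p, dx f w⟫) (puncDisk x R) ∧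
    ContDiffOn ℝ 1 (fun w => φ w * ⟪f w - p, dy f w⟫) (puncDisk x R) := by
  have h0 : ContDiffOn ℝ 1 (fun w => f w - p) (puncDisk x R) :=
    (hf.smooth.of_le (by norm_num)).sub contDiffOn_const
  exact ⟨hφ.mul (h0.inner ℝ hf.contDiffOn_dx), hφ.mul (h0.inner ℝ hf.contDiffOn_dy)⟩

/-- The area concentrates near a point of the surface: the weighted area `∫ s Φ² |∇f|²` is bounded
below for a suitable scale `s`. -/
lemma exists_scale (hrR : r ≤ R) {z₀ : ℝ × ℝ} (hz₀ : z₀ ∈ puncDisk x r) (hr : 0 ≤ r) :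
    ∃ s > 0, IntegrableOn (fun z => s * simonWeight f (f z₀) s z ^ 2 * energyDensity f z)
        (puncDisk x R) ∧
      1 / 9 ≤ ∫ z in puncDisk x r, s * simonWeight f (f z₀) s z ^ 2 * energyDensity f z := by
  have hsub : puncDisk x r ⊆ puncDisk x R := puncDisk_mono hr hrR
  have hzR := hsub hz₀
  have hint : ∀ s > 0, IntegrableOn
      (fun z => s * simonWeight f (f z₀) s z ^ 2 * energyDensity f z) (puncDisk x R) := by
    intro s hs
    refine Integrable.mono' (hf.energy_int.const_mul (1 / s)) ?_ ?_
    · exact ((((contDiffOn_simonWeight (hf.smooth.of_le (by norm_num)) hs _).continuousOn.pow 2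
        |> continuousOn_const.mul).mul hf.continuousOn_energyDensity)).aestronglyMeasurable
        isOpen_puncDisk.measurableSet
    · refine ae_of_all _ fun z => ?_
      have h0 := simonWeight_pos (f := f) hs (f z₀) z
      have h1 := simonWeight_mul (f := f) hs (f z₀) z
      have he := energyDensity_nonneg f z
      rw [Real.norm_of_nonneg (by positivity)]
      refine mul_le_mul_of_nonneg_right ?_ he
      have h2 : simonWeight f (f z₀) s z * s ≤ 1 := by
        nlinarith [mul_nonneg h0.le (sq_nonneg ‖f z - f z₀‖)]
      rw [le_div_iff₀ hs]
      nlinarith [mul_pos h0 hs]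
  set l := ‖dx f z₀‖ with hl
  have hγ : energyDensity f z₀ = 2 * l ^ 2 := by
    rw [energyDensity, ← hf.norm_eq z₀ hzR]; ring
  have hl0 : 0 < l := by
    have := hf.energy_pos z₀ hzR
    rw [hγ] at this
    exact lt_of_le_of_ne (norm_nonneg _) fun h => by rw [← h] at this; simp at this
  have hly : ‖dy f z₀‖ = l :=
    ((sq_eq_sq₀ (norm_nonneg _) (norm_nonneg _)).1 (hf.norm_eq z₀ hzR)).symm
  have hd := (differentiableAt_puncDisk (hf.smooth.of_le (by norm_num)) hzR).hasFDerivAt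
  have ev1 : ∀ᶠ z in 𝓝 z₀, ‖f z - f z₀ - fderiv ℝ f z₀ (z - z₀)‖ ≤ l * ‖z - z₀‖ :=
    hd.isLittleO.def hl0
  have ev2 : ∀ᶠ z in 𝓝 z₀, l ^ 2 < energyDensity f z :=
    (hf.continuousOn_energyDensity.continuousAt (isOpen_puncDisk.mem_nhds hzR)).eventually
      (lt_mem_nhds (by rw [hγ]; nlinarith))
  have ev3 : ∀ᶠ z in 𝓝 z₀, z ∈ puncDisk x r := isOpen_puncDisk.mem_nhds hz₀
  obtain ⟨ρ, hρ, hball⟩ := Metric.eventually_nhds_iff_ball.1 (ev1.and (ev2.and ev3))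
  set σ := 3 * l * ρ with hσ
  have hσ0 : 0 < σ := by positivity
  refine ⟨σ ^ 2, by positivity, hint _ (by positivity), ?_⟩
  have hvol : volume (Metric.ball z₀ ρ) = ENNReal.ofReal ((2 * ρ) ^ 2) := by
    have h1 : Metric.ball z₀ ρ = Metric.ball z₀.1 ρ ×ˢ Metric.ball z₀.2 ρ :=
      (ball_prod_same _ _ _).symm
    rw [h1, Measure.volume_eq_prod, Measure.prod_prod, Real.volume_ball, Real.volume_ball,
      ← ENNReal.ofReal_mul (by positivity), sq]
  have hconst : 1 / 9 = ∫ _ in Metric.ball z₀ ρ, 1 / (36 * ρ ^ 2) := by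
    rw [setIntegral_const, measureReal_def, hvol, ENNReal.toReal_ofReal (by positivity),
      smul_eq_mul]
    field_simp
    norm_num
  have hbs : Metric.ball z₀ ρ ⊆ puncDisk x r := fun z hz => (hball z hz).2.2
  have hi := (hint (σ ^ 2) (by positivity)).mono_set hsub
  rw [hconst]
  calc ∫ _ in Metric.ball z₀ ρ, 1 / (36 * ρ ^ 2)
      ≤ ∫ z in Metric.ball z₀ ρ,
          σ ^ 2 * simonWeight f (f z₀) (σ ^ 2) z ^ 2 * energyDensity f z := by
        refine setIntegral_mono_on ?_ (hi.mono_set hbs) Metric.isOpen_ball.measurableSet ?_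
        · exact integrableOn_const (by rw [hvol]; exact ENNReal.ofReal_ne_top)
        intro z hz
        obtain ⟨h1, h2, -⟩ := hball z hz
        have hzn : ‖z - z₀‖ ≤ ρ := by rw [← dist_eq_norm]; exact (Metric.mem_ball.1 hz).le
        have hfd : ‖fderiv ℝ f z₀ (z - z₀)‖ ≤ 2 * l * ‖z - z₀‖ := by
          have : fderiv ℝ f z₀ (z - z₀) = (z - z₀).1 • dx f z₀ + (z - z₀).2 • dy f z₀ :=
            fderiv_apply_eq f z₀ _ _
          rw [this]
          calc _ ≤ ‖(z - z₀).1‖ * l + ‖(z - z₀).2‖ * l := by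
                refine (norm_add_le _ _).trans ?_
                rw [norm_smul, norm_smul, hly]
            _ ≤ ‖z - z₀‖ * l + ‖z - z₀‖ * l := by
                gcongr
                · exact norm_fst_le _
                · exact norm_snd_le _
            _ = _ := by ring
        have hX : ‖f z - f z₀‖ ≤ σ := by
          calc ‖f z - f z₀‖ = ‖(f z - f z₀ - fderiv ℝ f z₀ (z - z₀)) + fderiv ℝ f z₀ (z - z₀)‖ := by
                rw [sub_add_cancel]
            _ ≤ l * ‖z - z₀‖ + 2 * l * ‖z - z₀‖ := (norm_add_le _ _).trans (add_le_add h1 hfd)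
            _ = 3 * l * ‖z - z₀‖ := by ring
            _ ≤ σ := by rw [hσ]; gcongr
        have hΦ : 1 / (2 * σ ^ 2) ≤ simonWeight f (f z₀) (σ ^ 2) z := by
          rw [simonWeight, ← one_div]
          apply one_div_le_one_div_of_le (by positivity)
          nlinarith [norm_nonneg (f z - f z₀)]
        calc 1 / (36 * ρ ^ 2) = σ ^ 2 * (1 / (2 * σ ^ 2)) ^ 2 * l ^ 2 := by
              rw [hσ]; field_simp; norm_num
          _ ≤ _ := by gcongr
    _ ≤ _ := by
        refine setIntegral_mono_set hi ?_ hbs.eventuallyLE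
        refine ae_of_all _ fun z => ?_
        have := energyDensity_nonneg f z
        have := simonWeight_pos (f := f) (s := σ ^ 2) (by positivity) (f z₀) z
        exact mul_nonneg (by positivity) (energyDensity_nonneg f z)

/-- A point of the surface over a disk is close to the image of the boundary circle. -/
lemma dist_sq_le (hr : 0 < r) (hrR : r < R) (hW : ∫ z in puncDisk x R, willmoreDensity f z ≤ 1 / 32)
    {z₀ : ℝ × ℝ} (hz₀ : z₀ ∈ puncDisk x r) {d : ℝ} (hd : 0 < d)
    (hdist : ∀ θ, d ≤ ‖f (polarPt x r θ) - f z₀‖) :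
    d ^ 2 ≤ 200 * π * (r ^ 2 * circleInt x (energyDensity f) r) := by
  obtain ⟨s, hs, hDint, hlow⟩ := hf.exists_scale hrR.le hz₀ hr.le
  have hsub : puncDisk x r ⊆ puncDisk x R := puncDisk_mono hr.le hrR.le
  set Φ := simonWeight f (f z₀) s with hΦ
  have hΦs : ContDiffOn ℝ 1 Φ (puncDisk x R) :=
    contDiffOn_simonWeight (hf.smooth.of_le (by norm_num)) hs _
  obtain ⟨hV1, hV2⟩ := hf.contDiffOn_field hΦs (f z₀)
  set D₁ : ℝ × ℝ → ℝ := fun z => s * Φ z ^ 2 * energyDensity f z with hD₁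
  have hD₁c : ContinuousOn D₁ (puncDisk x R) :=
    ((hΦs.continuousOn.pow 2) |> continuousOn_const.mul).mul hf.continuousOn_energyDensity
  have hD₁0 : ∀ z ∈ puncDisk x R, 0 ≤ D₁ z := fun z _ =>
    mul_nonneg (by positivity) (energyDensity_nonneg f z)
  have hD₁i := integrableOn_mul_circleInt hf.pos.le hD₁c hD₁0 hDint
  have hWi := hf.willmore_circle_int
  have hwc := hf.continuousOn_willmoreDensity
  have hflux := integral_le_flux hr hrR hV1 hV2 (D := fun z => D₁ z - 1 / 4 * willmoreDensity f z)
    (C := 1 / s) hf.continuousOn_energyDensity (fun z _ => energyDensity_nonneg f z)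
    hf.energy_circle_int
    (fun z _ => (field_sq_le _ _ z).trans (mul_le_mul_of_nonneg_right
      (simonWeight_sq_le hs _ z) (energyDensity_nonneg f z)))
    (hD₁c.sub (hwc.const_mul _)) (integrableOn_mul_circleInt_sub hD₁c hwc _ hD₁i hWi) (by
      intro z hz
      have hzR := hsub hz
      obtain ⟨ln1, ln2⟩ := laplace_normal isOpen_puncDisk hf.smooth hf.norm_eq hf.inner_eq hzR
      have hmono := monotonicity_pointwise (X := f z - f z₀) (hf.norm_eq z hzR)
        (hf.inner_eq z hzR) ln1 ln2 (hf.energy_pos z hzR) (simonWeight_mul hs (f z₀) z)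
      have hdf := differentiableAt_puncDisk (hf.smooth.of_le (by norm_num)) hzR
      rw [hf.div_field hΦs (f z₀) hzR]
      have e1 : dx Φ z = _ := fderiv_simonWeight hdf hs (f z₀) (1, 0)
      have e2 : dy Φ z = _ := fderiv_simonWeight hdf hs (f z₀) (0, 1)
      have h11 : fderiv ℝ f z (1, 0) = dx f z := rfl
      have h12 : fderiv ℝ f z (0, 1) = dy f z := rfl
      rw [h11] at e1
      rw [h12] at e2
      rw [e1, e2]
      simp only [hD₁, willmoreDensity, energyDensity]
      simp only [← hΦ] at hmono
      rw [← hΦ]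
      linarith)
  rw [integral_mul_circleInt_sub hD₁c hwc _ hD₁i hWi hrR.le,
    ← integral_puncDisk hr.le (hD₁c.mono hsub) (fun z hz => hD₁0 z (hsub hz)),
    ← integral_puncDisk hr.le (hwc.mono hsub) (fun z _ => willmoreDensity_nonneg f z)] at hflux
  have hWr : ∫ z in puncDisk x r, willmoreDensity f z ≤ 1 / 32 :=
    (setIntegral_mono_set hf.willmore_int (ae_of_all _ fun z => willmoreDensity_nonneg f z)
      hsub.eventuallyLE).trans hW
  set S := r ^ 2 * circleInt x (energyDensity f) r with hS
  have hup : ∀ lam > 0, circleInt x (fluxDensity x (fun w => Φ w * ⟪f w - f z₀, dx f w⟫)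
      (fun w => Φ w * ⟪f w - f z₀, dy f w⟫)) r ≤ π * lam + S / (2 * lam * d ^ 2) := by
    intro lam hlam
    have hgc := hf.continuousOn_energyDensity
    have h1 := circleInt_mono (x := x)
      (v := fun z => lam / 2 + r ^ 2 / (2 * lam * d ^ 2) * energyDensity f z)
      (contDiffOn_fluxDensity hV1 hV2).continuousOn
      (continuousOn_const.add (hgc.const_mul _)) hr hrR (fun θ => by
        have hsq := fluxDensity_polarPt_sq_le (x := x) (fun w => Φ w * ⟪f w - f z₀, dx f w⟫)
          (fun w => Φ w * ⟪f w - f z₀, dy f w⟫) r θ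
        have h2 := field_sq_le (f := f) (Φ (polarPt x r θ)) (f z₀) (polarPt x r θ)
        have h3 := mul_le_mul_of_nonneg_right (simonWeight_sq_mul_le_inv hs hd (hdist θ))
          (energyDensity_nonneg f (polarPt x r θ))
        have h4 := hsq.trans (mul_le_mul_of_nonneg_left (h2.trans h3) (sq_nonneg r))
        set y := fluxDensity x (fun w => Φ w * ⟪f w - f z₀, dx f w⟫)
          (fun w => Φ w * ⟪f w - f z₀, dy f w⟫) (polarPt x r θ)
        set g := energyDensity f (polarPt x r θ)
        have h5 : 2 * lam * y ≤ lam ^ 2 + y ^ 2 := by nlinarith [sq_nonneg (lam - y)]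
        have h6 : y ≤ (lam ^ 2 + r ^ 2 * (1 / d ^ 2 * g)) / (2 * lam) := by
          rw [le_div_iff₀ (by positivity)]; linarith
        refine h6.trans (le_of_eq ?_)
        field_simp)
    refine h1.trans (le_of_eq ?_)
    have hci := (continuous_comp_polarPt hgc hr hrR).intervalIntegrable (μ := volume) (-π) π
    rw [circleInt, intervalIntegral.integral_add (by simp) (hci.const_mul _),
      intervalIntegral.integral_const_mul, intervalIntegral.integral_const, hS, circleInt,
      smul_eq_mul]
    field_simp
    ring
  have h7 : 1 / 10 ≤ π * (1 / (20 * π)) + S / (2 * (1 / (20 * π)) * d ^ 2) := by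
    refine le_trans ?_ (hflux.trans (hup (1 / (20 * π)) (by positivity)))
    have : (1 : ℝ) / 10 ≤ 1 / 9 - 1 / 4 * (1 / 32) := by norm_num
    linarith
  have h8 : π * (1 / (20 * π)) + S / (2 * (1 / (20 * π)) * d ^ 2) = 1 / 20 + 10 * π * S / d ^ 2 := by
    field_simp
    ring
  rw [h8] at h7
  have h9 : 1 / 20 ≤ 10 * π * S / d ^ 2 := by linarith
  rw [le_div_iff₀ (by positivity)] at h9
  linarith

end IsConformalPuncture

end

section

lemma sq_intervalIntegral_le {u : ℝ → ℝ} (hu : Continuous u) {a b : ℝ} (hab : a < b) :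
    (∫ t in a..b, u t) ^ 2 ≤ (b - a) * ∫ t in a..b, u t ^ 2 := by
  set A := ∫ t in a..b, u t with hA
  set m := A / (b - a) with hm
  have hba : 0 < b - a := sub_pos.2 hab
  have h0 : 0 ≤ ∫ t in a..b, (u t - m) ^ 2 :=
    intervalIntegral.integral_nonneg hab.le fun _ _ => sq_nonneg _
  have h1 : ∫ t in a..b, (u t - m) ^ 2 = (∫ t in a..b, u t ^ 2) - 2 * m * A + m ^ 2 * (b - a) := by
    have e : ∀ t, (u t - m) ^ 2 = u t ^ 2 - 2 * m * u t + m ^ 2 := fun t => by ring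
    simp_rw [e]
    rw [intervalIntegral.integral_add (Continuous.intervalIntegrable (by fun_prop) _ _) (by simp),
      intervalIntegral.integral_sub (Continuous.intervalIntegrable (by fun_prop) _ _)
        (Continuous.intervalIntegrable (by fun_prop) _ _), intervalIntegral.integral_const_mul,
      intervalIntegral.integral_const, smul_eq_mul]
    ring
  have h2 : m * (b - a) = A := div_mul_cancel₀ A hba.ne'
  rw [h1] at h0
  have h3 : 0 ≤ (b - a) * ((∫ t in a..b, u t ^ 2) - 2 * m * A + m ^ 2 * (b - a)) :=
    mul_nonneg hba.le h0
  have h4 : (b - a) * ((∫ t in a..b, u t ^ 2) - 2 * m * A + m ^ 2 * (b - a)) =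
      (b - a) * (∫ t in a..b, u t ^ 2) - 2 * (m * (b - a)) * A + (m * (b - a)) ^ 2 := by ring
  rw [h4, h2] at h3
  linarith [sq A]

variable {F : Type*} [NormedAddCommGroup F] [InnerProductSpace ℝ F] [CompleteSpace F]

/-- Distance of an arc to the midpoint of its endpoints, and the corresponding flux bound. -/
lemma arc_bounds {φ φ' ψ : ℝ → F} (hd : ∀ t, HasDerivAt φ (φ' t) t) (hφ' : Continuous φ')
    (hψ : Continuous ψ) {a b : ℝ} (hab : a < b) {c : F} (hc : c = (2⁻¹ : ℝ) • (φ a + φ b)) :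
    (∀ t ∈ Icc a b, ‖φ t - c‖ ^ 2 ≤ (b - a) / 4 * ∫ t in a..b, (‖φ' t‖ ^ 2 + ‖ψ t‖ ^ 2)) ∧
    ∫ t in a..b, ⟪φ t - c, ψ t⟫ ≤ (b - a) / 4 * ∫ t in a..b, (‖φ' t‖ ^ 2 + ‖ψ t‖ ^ 2) := by
  have hba : 0 < b - a := sub_pos.2 hab
  have hφ : Continuous φ := continuous_iff_continuousAt.2 fun t => (hd t).continuousAt
  set P := ∫ t in a..b, ‖φ' t‖ with hP
  set Q := ∫ t in a..b, ‖ψ t‖ with hQ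
  have hP2 := sq_intervalIntegral_le hφ'.norm hab
  have hQ2 := sq_intervalIntegral_le hψ.norm hab
  have hadd : ∫ t in a..b, (‖φ' t‖ ^ 2 + ‖ψ t‖ ^ 2) =
      (∫ t in a..b, ‖φ' t‖ ^ 2) + ∫ t in a..b, ‖ψ t‖ ^ 2 :=
    intervalIntegral.integral_add (Continuous.intervalIntegrable (by fun_prop) _ _)
      (Continuous.intervalIntegrable (by fun_prop) _ _)
  have hψ0 : 0 ≤ ∫ t in a..b, ‖ψ t‖ ^ 2 :=
    intervalIntegral.integral_nonneg hab.le fun _ _ => sq_nonneg _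
  have hdist : ∀ t ∈ Icc a b, ‖φ t - c‖ ≤ P / 2 := by
    intro t ht
    have i1 : ∀ p q, IntervalIntegrable φ' volume p q := fun p q => hφ'.intervalIntegrable p q
    have i2 : ∀ p q, IntervalIntegrable (fun t => ‖φ' t‖) volume p q :=
      fun p q => hφ'.norm.intervalIntegrable p q
    have h1 := intervalIntegral.integral_eq_sub_of_hasDerivAt (fun s _ => hd s) (i1 a t)
    have h2 := intervalIntegral.integral_eq_sub_of_hasDerivAt (fun s _ => hd s) (i1 t b)
    have h3 := intervalIntegral.norm_integral_le_integral_norm (f := φ') (μ := volume) ht.1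
    have h4 := intervalIntegral.norm_integral_le_integral_norm (f := φ') (μ := volume) ht.2
    have h5 : φ t - c = (2⁻¹ : ℝ) • ((φ t - φ a) - (φ b - φ t)) := by
      rw [hc]; module
    have h6 : P = (∫ s in a..t, ‖φ' s‖) + ∫ s in t..b, ‖φ' s‖ :=
      (intervalIntegral.integral_add_adjacent_intervals (i2 a t) (i2 t b)).symm
    rw [h5, norm_smul, ← h1, ← h2, h6]
    have h7 := norm_sub_le (∫ s in a..t, φ' s) (∫ s in t..b, φ' s)
    norm_num
    linarith
  refine ⟨fun t ht => ?_, ?_⟩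
  · have h1 := pow_le_pow_left₀ (norm_nonneg _) (hdist t ht) 2
    rw [hadd]
    nlinarith
  · have h1 : ∫ t in a..b, ⟪φ t - c, ψ t⟫ ≤ ∫ t in a..b, P / 2 * ‖ψ t‖ := by
      refine intervalIntegral.integral_mono_on hab.le
        (Continuous.intervalIntegrable (by fun_prop) _ _)
        (Continuous.intervalIntegrable (by fun_prop) _ _) fun t ht => ?_
      exact (real_inner_le_norm _ _).trans
        (mul_le_mul_of_nonneg_right (hdist t ht) (norm_nonneg _))
    rw [intervalIntegral.integral_const_mul, ← hQ] at h1
    rw [hadd]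
    nlinarith [sq_nonneg (P - Q)]

omit [CompleteSpace F] in
lemma norm_sq_rotate (a b : F) (r θ : ℝ) :
    ‖-(r * Real.sin θ) • a + (r * Real.cos θ) • b‖ ^ 2 +
      ‖(r * Real.cos θ) • a + (r * Real.sin θ) • b‖ ^ 2 = r ^ 2 * (‖a‖ ^ 2 + ‖b‖ ^ 2) := by
  rw [norm_add_sq_real, norm_add_sq_real]
  simp only [norm_smul, inner_smul_left, inner_smul_right, mul_pow, Real.norm_eq_abs, sq_abs,
    conj_trivial, neg_sq]
  linear_combination r ^ 2 * (‖a‖ ^ 2 + ‖b‖ ^ 2) * Real.sin_sq_add_cos_sq θ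

lemma exists_angle_mem_Icc (x : ℝ × ℝ) (r θ : ℝ) :
    ∃ θ' ∈ Icc (-π) π, polarPt x r θ = polarPt x r θ' := by
  refine ⟨(θ : Real.Angle).toReal, Ioc_subset_Icc_self (Real.Angle.toReal_mem_Ioc _), ?_⟩
  simp [polarPt, Real.Angle.cos_toReal, Real.Angle.sin_toReal]

variable {f : ℝ × ℝ → F} {x : ℝ × ℝ} {R r : ℝ}

namespace IsConformalPuncture

variable (hf : IsConformalPuncture f x R)
include hf

omit [CompleteSpace F] in
lemma circleInt_energy_pos (hr : 0 < r) (hrR : r < R) : 0 < circleInt x (energyDensity f) r :=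
  intervalIntegral.intervalIntegral_pos_of_pos
    ((continuous_comp_polarPt hf.continuousOn_energyDensity hr hrR).intervalIntegrable _ _)
    (fun θ => hf.energy_pos _ (polarPt_mem hr hrR θ)) (by linarith [Real.pi_pos])

/-- On a circle, `f` is close to a single point relative to its energy. -/
lemma exists_circle_center (hr : 0 < r) (hrR : r < R) : ∃ c : F,
    (∀ θ, ‖f (polarPt x r θ) - c‖ ^ 2 ≤ π / 4 * (r ^ 2 * circleInt x (energyDensity f) r)) ∧
    circleInt x (fluxDensity x (fun w => 1 * ⟪f w - c, dx f w⟫)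
      (fun w => 1 * ⟪f w - c, dy f w⟫)) r ≤ π / 4 * (r ^ 2 * circleInt x (energyDensity f) r) := by
  have hsm : ContDiffOn ℝ 1 f (puncDisk x R) := hf.smooth.of_le (by norm_num)
  set φ : ℝ → F := fun θ => f (polarPt x r θ) with hφ
  set φ' : ℝ → F := fun θ =>
    -(r * Real.sin θ) • dx f (polarPt x r θ) + (r * Real.cos θ) • dy f (polarPt x r θ) with hφ'
  set ψ : ℝ → F := fun θ =>
    (r * Real.cos θ) • dx f (polarPt x r θ) + (r * Real.sin θ) • dy f (polarPt x r θ) with hψ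
  have hd : ∀ t, HasDerivAt φ (φ' t) t := fun θ => hasDerivAt_comp_angle hsm hr hrR θ
  have c1 := continuous_comp_polarPt (continuousOn_dx hsm) hr hrR
  have c2 := continuous_comp_polarPt (continuousOn_dy hsm) hr hrR
  have hφ'c : Continuous φ' := by fun_prop
  have hψc : Continuous ψ := by fun_prop
  have hφc : Continuous φ := continuous_comp_polarPt hsm.continuousOn hr hrR
  have hper : φ (-π) = φ π := by simp only [hφ, polarPt_periodic]
  set c : F := (2⁻¹ : ℝ) • (φ 0 + φ π) with hc
  obtain ⟨a1, a2⟩ := arc_bounds (a := -π) (b := 0) hd hφ'c hψc (by simp [Real.pi_pos]) (c := c)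
    (by rw [hc, hper, add_comm])
  obtain ⟨b1, b2⟩ := arc_bounds (a := 0) (b := π) hd hφ'c hψc Real.pi_pos hc
  set G : ℝ → ℝ := fun t => ‖φ' t‖ ^ 2 + ‖ψ t‖ ^ 2 with hG
  have hGc : Continuous G := by fun_prop
  have hGi : ∀ p q, IntervalIntegrable G volume p q := fun p q => hGc.intervalIntegrable p q
  have hsum : (∫ t in (-π)..0, G t) + ∫ t in (0 : ℝ)..π, G t =
      r ^ 2 * circleInt x (energyDensity f) r := by
    rw [intervalIntegral.integral_add_adjacent_intervals (hGi _ _) (hGi _ _), circleInt,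
      ← intervalIntegral.integral_const_mul]
    exact intervalIntegral.integral_congr fun θ _ => norm_sq_rotate _ _ r θ
  have hG0 : ∀ p q : ℝ, p ≤ q → 0 ≤ ∫ t in p..q, G t := fun p q hpq =>
    intervalIntegral.integral_nonneg hpq fun t _ => add_nonneg (sq_nonneg _) (sq_nonneg _)
  have g1 := hG0 (-π) 0 (by simp [Real.pi_pos.le])
  have g2 := hG0 0 π Real.pi_pos.le
  rw [← hsum]
  refine ⟨c, fun θ => ?_, ?_⟩
  · obtain ⟨t, ht, hθ⟩ := exists_angle_mem_Icc x r θ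
    rw [hθ]
    rcases le_total t 0 with h | h
    · have := a1 t ⟨ht.1, h⟩
      nlinarith [Real.pi_pos]
    · have := b1 t ⟨h, ht.2⟩
      nlinarith [Real.pi_pos]
  · have e : circleInt x (fluxDensity x (fun w => 1 * ⟪f w - c, dx f w⟫)
        (fun w => 1 * ⟪f w - c, dy f w⟫)) r = ∫ t in (-π)..π, ⟪φ t - c, ψ t⟫ := by
      refine intervalIntegral.integral_congr fun θ _ => ?_
      simp only [fluxDensity, hφ, hψ, inner_add_right, inner_smul_right]
      simp only [polarPt]
      ring
    have hI : ∀ p q, IntervalIntegrable (fun t => ⟪φ t - c, ψ t⟫) volume p q :=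
      fun p q => Continuous.intervalIntegrable (by fun_prop) _ _
    rw [e, ← intervalIntegral.integral_add_adjacent_intervals (hI (-π) 0) (hI 0 π)]
    linarith

/-- Over a disk, `f` is close to a single point relative to its energy on the boundary circle. -/
lemma exists_center (hr : 0 < r) (hrR : r < R)
    (hW : ∫ z in puncDisk x R, willmoreDensity f z ≤ 1 / 32) : ∃ c : F,
    (∀ z ∈ puncDisk x r, ‖f z - c‖ ^ 2 ≤ 1300 * (r ^ 2 * circleInt x (energyDensity f) r)) ∧
    circleInt x (fluxDensity x (fun w => 1 * ⟪f w - c, dx f w⟫)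
      (fun w => 1 * ⟪f w - c, dy f w⟫)) r ≤ π / 4 * (r ^ 2 * circleInt x (energyDensity f) r) := by
  obtain ⟨c, hc, hfl⟩ := hf.exists_circle_center hr hrR
  refine ⟨c, fun z hz => ?_, hfl⟩
  have hS : 0 < r ^ 2 * circleInt x (energyDensity f) r :=
    mul_pos (by positivity) (hf.circleInt_energy_pos hr hrR)
  set S := r ^ 2 * circleInt x (energyDensity f) r with hSdef
  have hpi := Real.pi_pos
  obtain ⟨θ, hθ⟩ : ∃ θ, ‖f (polarPt x r θ) - f z‖ < √(201 * π * S) := by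
    by_contra! h
    have := hf.dist_sq_le hr hrR hW hz (Real.sqrt_pos.2 (by positivity)) h
    rw [Real.sq_sqrt (by positivity)] at this
    nlinarith [mul_pos hpi hS]
  have h1 : ‖f (polarPt x r θ) - f z‖ ^ 2 < 201 * π * S := by
    rw [← Real.sq_sqrt (show 0 ≤ 201 * π * S by positivity)]
    exact pow_lt_pow_left₀ hθ (norm_nonneg _) two_ne_zero
  have h2 := hc θ
  have h3 : ‖f z - c‖ ≤ ‖f (polarPt x r θ) - f z‖ + ‖f (polarPt x r θ) - c‖ := by
    rw [← norm_neg (f (polarPt x r θ) - f z), neg_sub]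
    exact norm_sub_le_norm_sub_add_norm_sub _ _ _
  have h4 : ‖f z - c‖ ^ 2 ≤ 2 * (‖f (polarPt x r θ) - f z‖ ^ 2 + ‖f (polarPt x r θ) - c‖ ^ 2) := by
    have := pow_le_pow_left₀ (norm_nonneg _) h3 2
    nlinarith [sq_nonneg (‖f (polarPt x r θ) - f z‖ - ‖f (polarPt x r θ) - c‖)]
  have h5 : π * S ≤ 3.15 * S := mul_le_mul_of_nonneg_right Real.pi_lt_d2.le hS.le
  linarith

/-- The energy in a disk is controlled by the energy on its boundary circle, with a good
constant. -/
lemma energy_le (hr : 0 < r) (hrR : r < R)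
    (hW : ∫ z in puncDisk x R, willmoreDensity f z ≤ 1 / 10 ^ 7) :
    ∫ t in Ioo 0 r, t * circleInt x (energyDensity f) t ≤
      4 / 5 * (r ^ 2 * circleInt x (energyDensity f) r) := by
  obtain ⟨c, hc, hfl⟩ := hf.exists_center hr hrR (hW.trans (by norm_num))
  have hS : 0 < r ^ 2 * circleInt x (energyDensity f) r :=
    mul_pos (by positivity) (hf.circleInt_energy_pos hr hrR)
  set S := r ^ 2 * circleInt x (energyDensity f) r with hSdef
  have hsub : puncDisk x r ⊆ puncDisk x R := puncDisk_mono hr.le hrR.le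
  have h1s : ContDiffOn ℝ 1 (fun _ : ℝ × ℝ => (1 : ℝ)) (puncDisk x R) := contDiffOn_const
  obtain ⟨hV1, hV2⟩ := hf.contDiffOn_field h1s c
  have hWi := hf.willmore_circle_int
  have hwc := hf.continuousOn_willmoreDensity
  have hgc := hf.continuousOn_energyDensity
  have hg1c : ContinuousOn (fun z => 0.99 * energyDensity f z) (puncDisk x R) := hgc.const_mul _
  have hg1i : IntegrableOn (fun t => t * circleInt x (fun z => 0.99 * energyDensity f z) t)
      (Ioo 0 R) := by
    refine IntegrableOn.congr_fun (hf.energy_circle_int.const_mul 0.99) (fun t _ => ?_)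
      measurableSet_Ioo
    simp only [circleInt, intervalIntegral.integral_const_mul]
    ring
  have hflux := integral_le_flux hr hrR hV1 hV2
    (D := fun z => 0.99 * energyDensity f z - 32500 * S * willmoreDensity f z)
    (C := 1300 * S) hgc (fun z _ => energyDensity_nonneg f z) hf.energy_circle_int
    (fun z hz => (field_sq_le 1 c z).trans (mul_le_mul_of_nonneg_right
      (by rw [one_pow, one_mul]; exact hc z hz) (energyDensity_nonneg f z)))
    (hg1c.sub (hwc.const_mul _)) (integrableOn_mul_circleInt_sub hg1c hwc _ hg1i hWi) (by
      intro z hz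
      rw [hf.div_field h1s c (hsub hz)]
      have hg := hf.energy_pos z (hsub hz)
      have hX := hc z hz
      have hL : ‖laplace f z‖ ^ 2 = willmoreDensity f z * energyDensity f z :=
        (div_mul_cancel₀ _ hg.ne').symm
      have hw := willmoreDensity_nonneg f z
      set w := willmoreDensity f z
      set g := energyDensity f z
      have h1 : ⟪f z - c, laplace f z⟫ ^ 2 ≤ (0.01 * g + 32500 * S * w) ^ 2 := by
        calc ⟪f z - c, laplace f z⟫ ^ 2 ≤ ‖f z - c‖ ^ 2 * ‖laplace f z‖ ^ 2 := by
              rw [← mul_pow, ← sq_abs ⟪f z - c, laplace f z⟫]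
              exact pow_le_pow_left₀ (abs_nonneg _) (abs_real_inner_le_norm _ _) 2
          _ ≤ 1300 * S * (w * g) := by rw [hL]; gcongr
          _ ≤ _ := by nlinarith [sq_nonneg (0.01 * g - 32500 * S * w)]
      have h2 := neg_le_of_abs_le (abs_le_of_sq_le_sq h1 (by positivity))
      have h3 : dx (fun _ : ℝ × ℝ => (1 : ℝ)) z = 0 := by simp [dx]
      have h4 : dy (fun _ : ℝ × ℝ => (1 : ℝ)) z = 0 := by simp [dy]
      rw [h3, h4]
      linarith)
  have hWr : ∫ z in puncDisk x r, willmoreDensity f z ≤ 1 / 10 ^ 7 :=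
    (setIntegral_mono_set hf.willmore_int (ae_of_all _ fun z => willmoreDensity_nonneg f z)
      hsub.eventuallyLE).trans hW
  rw [integral_mul_circleInt_sub hg1c hwc _ hg1i hWi hrR.le,
    ← integral_puncDisk hr.le (hwc.mono hsub) (fun z _ => willmoreDensity_nonneg f z)] at hflux
  have e : ∫ t in Ioo 0 r, t * circleInt x (fun z => 0.99 * energyDensity f z) t =
      0.99 * ∫ t in Ioo 0 r, t * circleInt x (energyDensity f) t := by
    rw [← integral_const_mul]
    congr 1 with t
    simp only [circleInt, intervalIntegral.integral_const_mul]
    ring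
  rw [e] at hflux
  have h5 : π * S ≤ 3.1416 * S := mul_le_mul_of_nonneg_right Real.pi_lt_d4.le hS.le
  have h6 : 32500 * S * ∫ z in puncDisk x r, willmoreDensity f z ≤ 32500 * S * (1 / 10 ^ 7) :=
    mul_le_mul_of_nonneg_left hWr (by positivity)
  linarith

end IsConformalPuncture

end

section

/-- The squared Euclidean distance in the plane. -/
noncomputable def distSq (z x : ℝ × ℝ) : ℝ := (z.1 - x.1) ^ 2 + (z.2 - x.2) ^ 2

lemma continuous_distSq (x : ℝ × ℝ) : Continuous fun z => distSq z x := by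
  unfold distSq; fun_prop

lemma continuousOn_distSq_rpow (x : ℝ × ℝ) (R β : ℝ) :
    ContinuousOn (fun z => distSq z x ^ β) (puncDisk x R) :=
  (continuous_distSq x).continuousOn.rpow_const fun _ hz => Or.inl hz.1.ne'

/-- Polar coordinates with a radial power weight. -/
lemma lintegral_puncDisk_rpow {u : ℝ × ℝ → ℝ} {x : ℝ × ℝ} {R : ℝ} (hR : 0 ≤ R)
    (hu : ContinuousOn u (puncDisk x R)) (h0 : ∀ z ∈ puncDisk x R, 0 ≤ u z) (β : ℝ) :
    ∫⁻ z in puncDisk x R, ENNReal.ofReal (distSq z x ^ β * u z) =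
      ∫⁻ t in Ioo 0 R, ENNReal.ofReal (t ^ (1 + 2 * β) * circleInt x u t) := by
  refine (lintegral_puncDisk (u := fun z => distSq z x ^ β * u z) hR
    ((continuousOn_distSq_rpow x R β).mul hu)
    fun z hz => mul_nonneg (Real.rpow_nonneg hz.1.le _) (h0 z hz)).trans ?_
  refine setLIntegral_congr_fun measurableSet_Ioo fun t ht => ?_
  have h1 : ∀ θ, distSq (polarPt x t θ) x ^ β = t ^ (2 * β) := fun θ => by
    rw [distSq, polarPt_distSq, Real.rpow_mul ht.1.le, Real.rpow_two]
  simp only [circleInt, h1, intervalIntegral.integral_const_mul]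
  rw [Real.rpow_add ht.1, Real.rpow_one, mul_assoc]

/-- A Morrey type decay estimate for a function satisfying a reverse growth inequality. -/
lemma lintegral_rpow_le {e : ℝ → ℝ} {R r : ℝ} (hc : ContinuousOn e (Ioo 0 R))
    (he : ∀ t ∈ Ioo 0 R, 0 ≤ e t) (hi : IntegrableOn (fun t => t * e t) (Ioo 0 R))
    (hm : ∀ t ∈ Ioo 0 R, ∫ s in Ioo 0 t, s * e s ≤ 4 / 5 * (t ^ 2 * e t)) (hr : r ∈ Ioo 0 R) :
    ∫⁻ t in Ioo 0 r, ENNReal.ofReal (t ^ (-1 / 5 : ℝ) * e t) ≤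
      ENNReal.ofReal (25 * (r ^ (-6 / 5 : ℝ) * ∫ s in Ioo 0 r, s * e s)) := by
  set k : ℝ → ℝ := fun t => t * e t with hk
  have hkc : ContinuousOn k (Ioo 0 R) := continuousOn_id.mul hc
  set m : ℝ → ℝ := fun t => ∫ s in (0 : ℝ)..t, k s with hmdef
  have hmeq : ∀ t, 0 ≤ t → m t = ∫ s in Ioo 0 t, k s := fun t ht => by
    rw [hmdef]
    simp only
    rw [intervalIntegral.integral_of_le ht, integral_Ioc_eq_integral_Ioo]
  have hmd : ∀ t ∈ Ioo 0 R, HasDerivAt m (k t) t := by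
    intro t ht
    refine intervalIntegral.integral_hasDerivAt_right ?_ ?_ ?_
    · rw [intervalIntegrable_iff_integrableOn_Ioo_of_le ht.1.le]
      exact hi.mono_set (Ioo_subset_Ioo_right ht.2.le)
    · exact hkc.stronglyMeasurableAtFilter isOpen_Ioo t ht
    · exact hkc.continuousAt (isOpen_Ioo.mem_nhds ht)
  set h : ℝ → ℝ := fun t => t ^ (-6 / 5 : ℝ) * m t with hh
  have hhd : ∀ t ∈ Ioo 0 R, HasDerivAt h
      ((-6 / 5 : ℝ) * t ^ (-6 / 5 - 1 : ℝ) * m t + t ^ (-6 / 5 : ℝ) * k t) t := fun t ht =>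
    (Real.hasDerivAt_rpow_const (Or.inl ht.1.ne')).mul (hmd t ht)
  have hlow : ∀ t ∈ Ioo 0 R, 1 / 25 * (t ^ (-1 / 5 : ℝ) * e t) ≤
      (-6 / 5 : ℝ) * t ^ (-6 / 5 - 1 : ℝ) * m t + t ^ (-6 / 5 : ℝ) * k t := by
    intro t ht
    have h1 : t ^ (-1 / 5 : ℝ) = t ^ (-6 / 5 - 1 : ℝ) * t ^ 2 := by
      rw [← Real.rpow_two, ← Real.rpow_add ht.1]; norm_num
    have h2 : t ^ (-6 / 5 : ℝ) = t ^ (-6 / 5 - 1 : ℝ) * t := by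
      nth_rw 3 [← Real.rpow_one t]
      rw [← Real.rpow_add ht.1]; norm_num
    have h3 := hm t ht
    rw [← hmeq t ht.1.le] at h3
    have h4 : 0 < t ^ (-6 / 5 - 1 : ℝ) := Real.rpow_pos_of_pos ht.1 _
    rw [h1, h2, hk]
    nlinarith [mul_le_mul_of_nonneg_left h3 h4.le]
  have hm0 : ∀ t, 0 ≤ t → t ≤ R → 0 ≤ m t := fun t ht htR => by
    rw [hmeq t ht]
    exact setIntegral_nonneg measurableSet_Ioo fun s hs =>
      mul_nonneg hs.1.le (he s ⟨hs.1, hs.2.trans_le htR⟩)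
  have hqc : ContinuousOn (fun t => t ^ (-1 / 5 : ℝ) * e t) (Ioo 0 R) :=
    (continuousOn_id.rpow_const fun t ht => Or.inl ht.1.ne').mul hc
  have hmc : ContinuousOn m (Ioo 0 R) := fun t ht => (hmd t ht).continuousAt.continuousWithinAt
  have hseg : ∀ ε ∈ Ioo 0 r, ∫⁻ t in Ioc ε r, ENNReal.ofReal (t ^ (-1 / 5 : ℝ) * e t) ≤
      ENNReal.ofReal (25 * (r ^ (-6 / 5 : ℝ) * ∫ s in Ioo 0 r, s * e s)) := by
    intro ε hε
    have hsub : Icc ε r ⊆ Ioo 0 R := fun t ht => ⟨hε.1.trans_le ht.1, ht.2.trans_lt hr.2⟩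
    have hsub' : uIcc ε r ⊆ Ioo 0 R := by rwa [uIcc_of_le hε.2.le]
    rw [← ofReal_integral_eq_lintegral_ofReal]
    · refine ENNReal.ofReal_le_ofReal ?_
      have hdc : ContinuousOn (fun t =>
          (-6 / 5 : ℝ) * t ^ (-6 / 5 - 1 : ℝ) * m t + t ^ (-6 / 5 : ℝ) * k t) (Ioo 0 R) :=
        ((continuousOn_const.mul (continuousOn_id.rpow_const fun t ht => Or.inl ht.1.ne')).mul
          hmc).add ((continuousOn_id.rpow_const fun t ht => Or.inl ht.1.ne').mul hkc)
      have h1 := intervalIntegral.integral_eq_sub_of_hasDerivAt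
        (fun t ht => hhd t (hsub' ht)) ((hdc.mono hsub').intervalIntegrable)
      have h2 : ∫ t in ε..r, 1 / 25 * (t ^ (-1 / 5 : ℝ) * e t) ≤ h r - h ε := by
        rw [← h1]
        exact intervalIntegral.integral_mono_on hε.2.le
          ((hqc.mono hsub').intervalIntegrable.const_mul _) (hdc.mono hsub').intervalIntegrable
          fun t ht => hlow t (hsub ht)
      have h3 : 0 ≤ h ε := mul_nonneg (Real.rpow_nonneg hε.1.le _)
        (hm0 ε hε.1.le (hε.2.trans hr.2).le)
      rw [intervalIntegral.integral_const_mul, intervalIntegral.integral_of_le hε.2.le] at h2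
      have h4 : h r = r ^ (-6 / 5 : ℝ) * ∫ s in Ioo 0 r, s * e s := by
        rw [hh]; simp only; rw [hmeq r hr.1.le]
      rw [← h4]
      linarith
    · exact ((hqc.mono hsub).integrableOn_Icc).mono_set Ioc_subset_Icc_self
    · exact (ae_restrict_iff' measurableSet_Ioc).2 (ae_of_all _ fun t ht =>
        mul_nonneg (Real.rpow_nonneg (hε.1.trans ht.1).le _)
          (he t (hsub (Ioc_subset_Icc_self ht))))
  have hlim : Tendsto (fun n : ℕ => r / (n + 2 : ℝ)) atTop (𝓝 0) :=
    tendsto_const_nhds.div_atTop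
      (tendsto_atTop_add_const_right _ _ tendsto_natCast_atTop_atTop)
  have hcov := aecover_Ioo_of_Ioc (μ := (volume : Measure ℝ)) (B := r) hlim
    (tendsto_const_nhds (x := r) (f := atTop))
  have hmeas : AEMeasurable (fun t => ENNReal.ofReal (t ^ (-1 / 5 : ℝ) * e t))
      (volume.restrict (Ioo 0 r)) :=
    ((hqc.mono (Ioo_subset_Ioo_right hr.2.le)).aemeasurable measurableSet_Ioo).ennreal_ofReal
  refine le_of_tendsto (hcov.lintegral_tendsto_of_nat hmeas) (Eventually.of_forall fun n => ?_)
  refine le_trans (lintegral_mono' (Measure.restrict_mono le_rfl Measure.restrict_le_self) le_rfl)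
    (hseg (r / (n + 2 : ℝ)) ⟨by have := hr.1; positivity, ?_⟩)
  rw [div_lt_iff₀ (by positivity)]
  nlinarith [hr.1, (Nat.cast_nonneg n : (0 : ℝ) ≤ n)]

variable {F : Type*} [NormedAddCommGroup F] [InnerProductSpace ℝ F] [CompleteSpace F]
  {f : ℝ × ℝ → F} {x : ℝ × ℝ} {R r : ℝ}

/-- Morrey decay of the energy around a puncture. -/
lemma IsConformalPuncture.lintegral_circle_le (hf : IsConformalPuncture f x R)
    (hW : ∫ z in puncDisk x R, willmoreDensity f z ≤ 1 / 10 ^ 7) (hr : r ∈ Ioo 0 R) :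
    ∫⁻ t in Ioo 0 r, ENNReal.ofReal (t ^ (-1 / 5 : ℝ) * circleInt x (energyDensity f) t) ≤
      ENNReal.ofReal (25 * (r ^ (-6 / 5 : ℝ) * ∫ z in puncDisk x r, energyDensity f z)) := by
  rw [integral_puncDisk hr.1.le
    (hf.continuousOn_energyDensity.mono (puncDisk_mono hr.1.le hr.2.le))
    fun z _ => energyDensity_nonneg f z]
  exact lintegral_rpow_le (continuousOn_circleInt hf.continuousOn_energyDensity)
    (fun t ht => circleInt_nonneg (fun z _ => energyDensity_nonneg f z) ht.1 ht.2)
    hf.energy_circle_int (fun t ht => hf.energy_le ht.1 ht.2 hW) hr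

end

section

section MeanValue

variable {G : Type*} [NormedAddCommGroup G] [NormedSpace ℝ G] {x : ℝ × ℝ} {R : ℝ}

/-- If the radial derivative of the circle averages of `u` is controlled by `N`, the value at the
centre is controlled by any circle average of `u` and the integral of `N`. -/
lemma norm_center_le [CompleteSpace G] {u v : ℝ × ℝ → G} {N : ℝ × ℝ → ℝ} (hux : ContinuousAt u x)
    (hu : ContinuousOn u (puncDisk x R)) (hv : ContinuousOn v (puncDisk x R))
    (hN : ContinuousOn N (puncDisk x R)) (hvN : ∀ z ∈ puncDisk x R, ‖v z‖ ≤ N z)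
    (hd : ∀ s ∈ Ioo 0 R, HasDerivAt (circleInt x u) (circleInt x v s) s) {t : ℝ}
    (ht : t ∈ Ioo 0 R) :
    ENNReal.ofReal (2 * π * ‖u x‖) ≤ ENNReal.ofReal (circleInt x (fun z => ‖u z‖) t) +
      ∫⁻ s in Ioo 0 R, ENNReal.ofReal (circleInt x N s) := by
  have hpi := Real.pi_pos
  have hN0 : ∀ z ∈ puncDisk x R, 0 ≤ N z := fun z hz => (norm_nonneg _).trans (hvN z hz)
  rcases eq_or_ne (∫⁻ s in Ioo 0 R, ENNReal.ofReal (circleInt x N s)) ⊤ with hJ | hJ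
  · rw [hJ, add_top]; exact le_top
  have hcN : ContinuousOn (circleInt x N) (Ioo 0 R) := continuousOn_circleInt hN
  have hcN0 : ∀ s ∈ Ioo 0 R, 0 ≤ circleInt x N s := fun s hs => circleInt_nonneg hN0 hs.1 hs.2
  have hNi : IntegrableOn (circleInt x N) (Ioo 0 R) := by
    refine ⟨hcN.aestronglyMeasurable measurableSet_Ioo, ?_⟩
    rw [hasFiniteIntegral_iff_ofReal ((ae_restrict_iff' measurableSet_Ioo).2 (ae_of_all _ hcN0))]
    exact hJ.lt_top
  rw [← ofReal_integral_eq_lintegral_ofReal hNi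
    ((ae_restrict_iff' measurableSet_Ioo).2 (ae_of_all _ hcN0)), ← ENNReal.ofReal_add
    (circleInt_nonneg (R := R) (fun z _ => norm_nonneg _) ht.1 ht.2)
    (setIntegral_nonneg measurableSet_Ioo hcN0)]
  refine ENNReal.ofReal_le_ofReal (le_of_forall_pos_le_add fun η hη => ?_)
  set η' := η / (2 * π) with hη'
  have hη'0 : 0 < η' := by positivity
  obtain ⟨δ, hδ, hball⟩ := Metric.continuousAt_iff.1 hux η' hη'0
  set ε := min (δ / 2) (t / 2) with hε
  have hε0 : 0 < ε := lt_min (by positivity) (by linarith [ht.1])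
  have hεt : ε < t := (min_le_right _ _).trans_lt (by linarith [ht.1])
  have hεδ : ε < δ := (min_le_left _ _).trans_lt (by linarith)
  have hεR : ε < R := hεt.trans ht.2
  have h1 : ‖(2 * π) • u x - circleInt x u ε‖ ≤ η := by
    have e1 : (2 * π) • u x - circleInt x u ε = ∫ θ in (-π)..π, (u x - u (polarPt x ε θ)) := by
      rw [intervalIntegral.integral_sub (by simp)
        ((continuous_comp_polarPt hu hε0 hεR).intervalIntegrable _ _),
        intervalIntegral.integral_const, circleInt]
      congr 2
      ring
    rw [e1]
    have h2 : ∀ θ ∈ uIoc (-π) π, ‖u x - u (polarPt x ε θ)‖ ≤ η' := by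
      intro θ _
      rw [← dist_eq_norm, dist_comm]
      refine (hball ?_).le
      rw [Prod.dist_eq, max_lt_iff, Real.dist_eq, Real.dist_eq]
      simp only [polarPt, add_sub_cancel_left, abs_mul, abs_of_pos hε0]
      constructor
      · exact (mul_le_of_le_one_right hε0.le (Real.abs_cos_le_one θ)).trans_lt hεδ
      · exact (mul_le_of_le_one_right hε0.le (Real.abs_sin_le_one θ)).trans_lt hεδ
    refine (intervalIntegral.norm_integral_le_of_norm_le_const h2).trans (le_of_eq ?_)
    rw [show π - -π = 2 * π by ring, abs_of_pos (by positivity), hη']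
    field_simp
  have hsub : Icc ε t ⊆ Ioo 0 R := fun s hs => ⟨hε0.trans_le hs.1, hs.2.trans_lt ht.2⟩
  have hsub' : uIcc ε t ⊆ Ioo 0 R := by rwa [uIcc_of_le hεt.le]
  have hcv : ContinuousOn (circleInt x v) (Ioo 0 R) := continuousOn_circleInt hv
  have h3 := intervalIntegral.integral_eq_sub_of_hasDerivAt
    (fun s hs => hd s (hsub' hs)) (hcv.mono hsub').intervalIntegrable
  have h4 : ‖circleInt x u t - circleInt x u ε‖ ≤ ∫ s in Ioo 0 R, circleInt x N s := by
    rw [← h3]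
    refine (intervalIntegral.norm_integral_le_integral_norm hεt.le).trans ?_
    have h5 : ∫ s in ε..t, ‖circleInt x v s‖ ≤ ∫ s in ε..t, circleInt x N s := by
      refine intervalIntegral.integral_mono_on hεt.le (hcv.mono hsub').norm.intervalIntegrable
        (hcN.mono hsub').intervalIntegrable fun s hs => ?_
      have hs' := hsub hs
      refine (intervalIntegral.norm_integral_le_integral_norm (by linarith)).trans ?_
      exact circleInt_mono hv.norm hN hs'.1 hs'.2 fun θ => hvN _ (polarPt_mem hs'.1 hs'.2 θ)
    refine h5.trans ?_
    rw [intervalIntegral.integral_of_le hεt.le]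
    exact setIntegral_mono_set hNi ((ae_restrict_iff' measurableSet_Ioo).2 (ae_of_all _ hcN0))
      (Ioc_subset_Icc_self.trans hsub).eventuallyLE
  have h6 : ‖circleInt x u t‖ ≤ circleInt x (fun z => ‖u z‖) t :=
    intervalIntegral.norm_integral_le_integral_norm (by linarith)
  have h7 : (2 * π) • u x = ((2 * π) • u x - circleInt x u ε) + circleInt x u t -
      (circleInt x u t - circleInt x u ε) := by abel
  have h8 : ‖(2 * π) • u x‖ = 2 * π * ‖u x‖ := by
    rw [norm_smul, Real.norm_of_nonneg (by positivity)]
  rw [← h8, h7]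
  refine (norm_sub_le _ _).trans ?_
  have := norm_add_le ((2 * π) • u x - circleInt x u ε) (circleInt x u t)
  linarith

end MeanValue

variable {F : Type*} [NormedAddCommGroup F] [InnerProductSpace ℝ F]
  {f : ℝ × ℝ → F} {x : ℝ × ℝ} {R r : ℝ}

/-- The coordinates of the outward unit normal. -/
noncomputable def radial (x z : ℝ × ℝ) : ℝ × ℝ :=
  ((z.1 - x.1) / √(distSq z x), (z.2 - x.2) / √(distSq z x))

lemma radial_polarPt (hr : 0 < r) (θ : ℝ) :
    radial x (polarPt x r θ) = (Real.cos θ, Real.sin θ) := by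
  rw [radial, distSq, polarPt_distSq, Real.sqrt_sq hr.le]
  simp only [polarPt, add_sub_cancel_left]
  rw [mul_div_cancel_left₀ _ hr.ne', mul_div_cancel_left₀ _ hr.ne']

lemma continuousOn_radial : ContinuousOn (radial x) (puncDisk x R) := by
  have h := (continuous_distSq x).continuousOn (s := puncDisk x R)
  refine ContinuousOn.prodMk ?_ ?_
  · exact ContinuousOn.div (by fun_prop) h.sqrt fun z hz => (Real.sqrt_pos.2 hz.1).ne'
  · exact ContinuousOn.div (by fun_prop) h.sqrt fun z hz => (Real.sqrt_pos.2 hz.1).ne'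

lemma abs_radial_le (hR : 0 ≤ R) {z : ℝ × ℝ} (hz : z ∈ puncDisk x R) :
    |(radial x z).1| ≤ 1 ∧ |(radial x z).2| ≤ 1 := by
  obtain ⟨r, θ, hr, -, rfl⟩ := exists_polarPt hz hR
  rw [radial_polarPt hr]
  exact ⟨Real.abs_cos_le_one θ, Real.abs_sin_le_one θ⟩

lemma hasDerivAt_circleInt_dx [CompleteSpace F] (hf : ContDiffOn ℝ 2 f (puncDisk x R))
    (hr : r ∈ Ioo 0 R) : HasDerivAt (circleInt x (dx f))
      (circleInt x (fun z => (radial x z).1 • laplace f z) r) r := by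
  refine hasDerivAt_circleInt_of_flux (contDiffOn_dx isOpen_puncDisk hf)
    (contDiffOn_dy isOpen_puncDisk hf) hr.1 hr.2 fun θ => ?_
  beta_reduce
  rw [radial_polarPt hr.1, laplace, dx_dy_comm isOpen_puncDisk hf (polarPt_mem hr.1 hr.2 θ)]
  module

lemma hasDerivAt_circleInt_dy [CompleteSpace F] (hf : ContDiffOn ℝ 2 f (puncDisk x R))
    (hr : r ∈ Ioo 0 R) : HasDerivAt (circleInt x (dy f))
      (circleInt x (fun z => (radial x z).2 • laplace f z) r) r := by
  have hn : ∀ z, fderiv ℝ (fun z => -dx f z) z = -fderiv ℝ (dx f) z := fun z => fderiv_fun_neg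
  refine hasDerivAt_circleInt_of_flux (contDiffOn_dy isOpen_puncDisk hf)
    (contDiffOn_dx isOpen_puncDisk hf).neg hr.1 hr.2 fun θ => ?_
  have h1 : ∀ z, dx (fun z => -dx f z) z = -dx (dx f) z := fun z => by
    rw [dx, hn]; rfl
  have h2 : ∀ z, dy (fun z => -dx f z) z = -dy (dx f) z := fun z => by
    rw [dy, hn]; rfl
  beta_reduce
  rw [radial_polarPt hr.1, laplace, dx_dy_comm isOpen_puncDisk hf (polarPt_mem hr.1 hr.2 θ), h1, h2]
  module

lemma sq_circleInt_le {u : ℝ × ℝ → ℝ} (hu : ContinuousOn u (puncDisk x R)) (hr : r ∈ Ioo 0 R) :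
    circleInt x u r ^ 2 ≤ 2 * π * circleInt x (fun z => u z ^ 2) r := by
  have := sq_intervalIntegral_le (continuous_comp_polarPt hu hr.1 hr.2) (a := -π) (b := π)
    (by linarith [Real.pi_pos])
  rwa [show π - -π = 2 * π by ring] at this

lemma ENNReal_add_sq_le (a b : ℝ≥0∞) : (a + b) ^ 2 ≤ 2 * a ^ 2 + 2 * b ^ 2 := by
  have h := ENNReal.rpow_add_le_mul_rpow_add_rpow a b (p := 2) (by norm_num)
  norm_num at h
  rw [mul_add] at h
  exact_mod_cast h

/-- The Cauchy-Schwarz inequality for lower integrals. -/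
lemma lintegral_mul_sq_le {α : Type*} [MeasurableSpace α] {μ : Measure α} {u v : α → ℝ≥0∞}
    (hu : AEMeasurable u μ) (hv : AEMeasurable v μ) :
    (∫⁻ a, u a * v a ∂μ) ^ 2 ≤ (∫⁻ a, u a ^ 2 ∂μ) * ∫⁻ a, v a ^ 2 ∂μ := by
  have h := ENNReal.lintegral_mul_le_Lp_mul_Lq μ (p := 2) (q := 2)
    (Real.holderConjugate_iff.2 (by norm_num)) hu hv
  simp only [Pi.mul_apply, ENNReal.rpow_two] at h
  refine (pow_le_pow_left' h 2).trans (le_of_eq ?_)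
  rw [mul_pow, ← ENNReal.rpow_natCast, ← ENNReal.rpow_natCast, ← ENNReal.rpow_mul,
    ← ENNReal.rpow_mul]
  norm_num

/-- The energy density at the centre of a disk. -/
lemma energyDensity_center_le [CompleteSpace F] (hf : ContDiffOn ℝ 2 f (puncDisk x R))
    (hx : ContinuousAt (dx f) x) (hy : ContinuousAt (dy f) x) {t : ℝ} (ht : t ∈ Ioo 0 R) :
    ENNReal.ofReal (energyDensity f x) ≤ ENNReal.ofReal (circleInt x (energyDensity f) t) +
      (∫⁻ s in Ioo 0 R, ENNReal.ofReal (circleInt x (fun z => ‖laplace f z‖) s)) ^ 2 := by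
  have hR : 0 ≤ R := (ht.1.trans ht.2).le
  set J := ∫⁻ s in Ioo 0 R, ENNReal.ofReal (circleInt x (fun z => ‖laplace f z‖) s) with hJ
  have hLc := continuousOn_laplace isOpen_puncDisk hf
  have c1 := (contDiffOn_dx isOpen_puncDisk hf).continuousOn
  have c2 := (contDiffOn_dy isOpen_puncDisk hf).continuousOn
  have hpi := Real.pi_gt_three
  have key : ∀ u : ℝ × ℝ → F, ContinuousOn u (puncDisk x R) →
      ENNReal.ofReal (2 * π * ‖u x‖) ≤ ENNReal.ofReal (circleInt x (fun z => ‖u z‖) t) + J →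
      ENNReal.ofReal (‖u x‖ ^ 2) ≤
        ENNReal.ofReal (circleInt x (fun z => ‖u z‖ ^ 2) t) + 2⁻¹ * J ^ 2 := by
    intro u hu h
    have h1 := (pow_le_pow_left' h 2).trans (ENNReal_add_sq_le _ _)
    have h2 := sq_circleInt_le hu.norm ht
    have hc0 : 0 ≤ circleInt x (fun z => ‖u z‖) t :=
      circleInt_nonneg (R := R) (fun z _ => norm_nonneg _) ht.1 ht.2
    have hc1 : 0 ≤ circleInt x (fun z => ‖u z‖ ^ 2) t :=
      circleInt_nonneg (R := R) (fun z _ => by positivity) ht.1 ht.2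
    rw [← ENNReal.ofReal_pow (by positivity), ← ENNReal.ofReal_pow hc0] at h1
    have h3 : ENNReal.ofReal (4 * π ^ 2) * ENNReal.ofReal (‖u x‖ ^ 2) ≤
        ENNReal.ofReal (4 * π ^ 2) *
          (ENNReal.ofReal (circleInt x (fun z => ‖u z‖ ^ 2) t) + 2⁻¹ * J ^ 2) := by
      calc ENNReal.ofReal (4 * π ^ 2) * ENNReal.ofReal (‖u x‖ ^ 2)
          = ENNReal.ofReal ((2 * π * ‖u x‖) ^ 2) := by
            rw [← ENNReal.ofReal_mul (by positivity)]; congr 1; ring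
        _ ≤ 2 * ENNReal.ofReal (circleInt x (fun z => ‖u z‖) t ^ 2) + 2 * J ^ 2 := h1
        _ ≤ ENNReal.ofReal (4 * π ^ 2) * ENNReal.ofReal (circleInt x (fun z => ‖u z‖ ^ 2) t) +
            ENNReal.ofReal (4 * π ^ 2) * (2⁻¹ * J ^ 2) := by
            gcongr ?_ + ?_
            · rw [← ENNReal.ofReal_mul (by positivity), ← ENNReal.ofReal_ofNat,
                ← ENNReal.ofReal_mul (by positivity)]
              apply ENNReal.ofReal_le_ofReal
              nlinarith
            · rw [← mul_assoc]
              gcongr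
              have : (2 : ℝ≥0∞) = 4 * 2⁻¹ := by
                rw [show (4 : ℝ≥0∞) = 2 * 2 by norm_num, mul_assoc,
                  ENNReal.mul_inv_cancel two_ne_zero ENNReal.ofNat_ne_top, mul_one]
              nth_rw 1 [this]
              gcongr
              rw [← ENNReal.ofReal_ofNat]
              apply ENNReal.ofReal_le_ofReal
              nlinarith
        _ = _ := (mul_add _ _ _).symm
    exact (ENNReal.mul_le_mul_iff_right (by positivity) ENNReal.ofReal_ne_top).1 h3
  have k1 := key (dx f) c1 (norm_center_le hx c1
    (v := fun z => (radial x z).1 • laplace f z)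
    ((continuous_fst.comp_continuousOn continuousOn_radial).smul hLc) hLc.norm
    (fun z hz => by
      rw [norm_smul]
      exact mul_le_of_le_one_left (norm_nonneg _) (abs_radial_le hR hz).1)
    (fun s hs => hasDerivAt_circleInt_dx hf hs) ht)
  have k2 := key (dy f) c2 (norm_center_le hy c2
    (v := fun z => (radial x z).2 • laplace f z)
    ((continuous_snd.comp_continuousOn continuousOn_radial).smul hLc) hLc.norm
    (fun z hz => by
      rw [norm_smul]
      exact mul_le_of_le_one_left (norm_nonneg _) (abs_radial_le hR hz).2)
    (fun s hs => hasDerivAt_circleInt_dy hf hs) ht)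
  have e1 : circleInt x (energyDensity f) t =
      circleInt x (fun z => ‖dx f z‖ ^ 2) t + circleInt x (fun z => ‖dy f z‖ ^ 2) t :=
    intervalIntegral.integral_add
      ((continuous_comp_polarPt (c1.norm.pow 2) ht.1 ht.2).intervalIntegrable _ _)
      ((continuous_comp_polarPt (c2.norm.pow 2) ht.1 ht.2).intervalIntegrable _ _)
  have e2 : (2⁻¹ : ℝ≥0∞) * J ^ 2 + 2⁻¹ * J ^ 2 = J ^ 2 := by
    rw [← add_mul, ENNReal.inv_two_add_inv_two, one_mul]
  rw [e1, energyDensity, ENNReal.ofReal_add (by positivity) (by positivity), ENNReal.ofReal_add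
    (circleInt_nonneg (R := R) (fun z _ => by positivity) ht.1 ht.2)
    (circleInt_nonneg (R := R) (fun z _ => by positivity) ht.1 ht.2), ← e2]
  refine (add_le_add k1 k2).trans (le_of_eq (by ring))

end

section

variable {F : Type*} [NormedAddCommGroup F] [InnerProductSpace ℝ F]
  {f : ℝ × ℝ → F} {x : ℝ × ℝ} {R r : ℝ}

/-- The Cauchy-Schwarz inequality for square roots of nonnegative functions. -/
lemma lintegral_ofReal_sq_le {α : Type*} [MeasurableSpace α] {μ : Measure α} {s : Set α}
    (hs : MeasurableSet s) {p a b : α → ℝ} (ha : AEMeasurable a (μ.restrict s))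
    (hb : AEMeasurable b (μ.restrict s)) (ha0 : ∀ z ∈ s, 0 ≤ a z)
    (hp : ∀ z ∈ s, p z ^ 2 ≤ a z * b z) :
    (∫⁻ z in s, ENNReal.ofReal (p z) ∂μ) ^ 2 ≤
      (∫⁻ z in s, ENNReal.ofReal (a z) ∂μ) * ∫⁻ z in s, ENNReal.ofReal (b z) ∂μ := by
  have h1 : ∫⁻ z in s, ENNReal.ofReal (p z) ∂μ ≤
      ∫⁻ z in s, ENNReal.ofReal √(a z) * ENNReal.ofReal √(b z) ∂μ := by
    refine setLIntegral_mono' hs fun z hz => ?_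
    rw [← ENNReal.ofReal_mul (Real.sqrt_nonneg _), ← Real.sqrt_mul (ha0 z hz)]
    exact ENNReal.ofReal_le_ofReal (Real.le_sqrt_of_sq_le (hp z hz))
  refine (pow_le_pow_left' h1 2).trans ((lintegral_mul_sq_le ha.sqrt.ennreal_ofReal
    hb.sqrt.ennreal_ofReal).trans (le_of_eq ?_))
  have h2 : ∀ c : ℝ, ENNReal.ofReal √c ^ 2 = ENNReal.ofReal c := fun c => by
    rcases le_total 0 c with hc | hc
    · rw [← ENNReal.ofReal_pow (Real.sqrt_nonneg _), Real.sq_sqrt hc]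
    · rw [Real.sqrt_eq_zero_of_nonpos hc, ENNReal.ofReal_of_nonpos hc]; simp
  simp only [h2]

namespace IsConformalPuncture

variable (hf : IsConformalPuncture f x R)
include hf

lemma norm_laplace_sq {z : ℝ × ℝ} (hz : z ∈ puncDisk x R) :
    ‖laplace f z‖ ^ 2 = willmoreDensity f z * energyDensity f z :=
  (div_mul_cancel₀ _ (hf.energy_pos z hz).ne').symm

/-- The energy density at a regular point is controlled by Riesz potentials of the energy density
and the Willmore density. -/
lemma energyDensity_le_potential [CompleteSpace F] (hx : ContinuousAt (dx f) x)
    (hy : ContinuousAt (dy f) x) :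
    ENNReal.ofReal (energyDensity f x) ≤
      (∫⁻ t in Ioo 0 R, ENNReal.ofReal (t ^ (-1 / 5 : ℝ) * circleInt x (energyDensity f) t)) *
      (ENNReal.ofReal (R ^ (-4 / 5 : ℝ)) +
        ∫⁻ z in puncDisk x R, ENNReal.ofReal (distSq z x ^ (-2 / 5 : ℝ) * willmoreDensity f z)) := by
  have hR := hf.pos
  have hgc := hf.continuousOn_energyDensity
  have hwc := hf.continuousOn_willmoreDensity
  have hLc := (continuousOn_laplace isOpen_puncDisk hf.smooth).norm
  have hm := (isOpen_puncDisk (x := x) (R := R)).measurableSet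
  set K := ∫⁻ t in Ioo 0 R, ENNReal.ofReal (t ^ (-1 / 5 : ℝ) * circleInt x (energyDensity f) t)
    with hK
  set M := ∫⁻ z in puncDisk x R, ENNReal.ofReal (distSq z x ^ (-2 / 5 : ℝ) * willmoreDensity f z)
    with hM
  set J := ∫⁻ s in Ioo 0 R, ENNReal.ofReal (circleInt x (fun z => ‖laplace f z‖) s) with hJ
  have hJ2 : J ^ 2 ≤ K * M := by
    have e1 : J = ∫⁻ z in puncDisk x R,
        ENNReal.ofReal (distSq z x ^ (-1 / 2 : ℝ) * ‖laplace f z‖) := by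
      rw [lintegral_puncDisk_rpow hR.le hLc (fun z _ => norm_nonneg _)]
      norm_num
      rfl
    have e2 : K = ∫⁻ z in puncDisk x R,
        ENNReal.ofReal (distSq z x ^ (-3 / 5 : ℝ) * energyDensity f z) := by
      rw [lintegral_puncDisk_rpow hR.le hgc (fun z _ => energyDensity_nonneg f z),
        show (1 + 2 * (-3 / 5) : ℝ) = -1 / 5 by norm_num]
    rw [e1, e2, hM]
    refine lintegral_ofReal_sq_le hm
      (((continuousOn_distSq_rpow x R _).mul hgc).aemeasurable hm)
      (((continuousOn_distSq_rpow x R _).mul hwc).aemeasurable hm)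
      (fun z hz => mul_nonneg (Real.rpow_nonneg hz.1.le _) (energyDensity_nonneg f z))
      fun z hz => le_of_eq ?_
    have h1 : (distSq z x ^ (-1 / 2 : ℝ)) ^ 2 =
        distSq z x ^ (-3 / 5 : ℝ) * distSq z x ^ (-2 / 5 : ℝ) := by
      have hz0 : 0 < distSq z x := hz.1
      rw [← Real.rpow_add hz0, ← Real.rpow_natCast, ← Real.rpow_mul hz0.le]
      norm_num
    rw [mul_pow, h1, hf.norm_laplace_sq hz]
    ring
  have h1 : ENNReal.ofReal R * ENNReal.ofReal (energyDensity f x) ≤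
      ENNReal.ofReal (R ^ (1 / 5 : ℝ)) * K + ENNReal.ofReal R * J ^ 2 := by
    have e1 : ∀ c : ℝ≥0∞, ENNReal.ofReal R * c = ∫⁻ _ in Ioo 0 R, c := fun c => by
      rw [setLIntegral_const, Real.volume_Ioo, sub_zero, mul_comm]
    rw [e1, e1]
    have h2 : ENNReal.ofReal (R ^ (1 / 5 : ℝ)) * K = ∫⁻ t in Ioo 0 R,
        ENNReal.ofReal (R ^ (1 / 5 : ℝ)) *
        ENNReal.ofReal (t ^ (-1 / 5 : ℝ) * circleInt x (energyDensity f) t) :=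
      (lintegral_const_mul' _ _ ENNReal.ofReal_ne_top).symm
    rw [h2, ← lintegral_add_right _ measurable_const]
    refine setLIntegral_mono' measurableSet_Ioo fun t ht => ?_
    refine (energyDensity_center_le hf.smooth hx hy ht).trans ?_
    gcongr
    rw [← ENNReal.ofReal_mul (Real.rpow_nonneg hR.le _)]
    apply ENNReal.ofReal_le_ofReal
    have he := circleInt_nonneg (fun z _ => energyDensity_nonneg f z) ht.1 ht.2 (x := x)
    rw [← mul_assoc]
    refine le_mul_of_one_le_left he ?_
    calc (1 : ℝ) = t ^ (1 / 5 : ℝ) * t ^ (-1 / 5 : ℝ) := by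
          rw [← Real.rpow_add ht.1]; norm_num
      _ ≤ _ := mul_le_mul_of_nonneg_right
          (Real.rpow_le_rpow ht.1.le ht.2.le (by norm_num)) (Real.rpow_nonneg ht.1.le _)
  have h3 : ENNReal.ofReal (R ^ (1 / 5 : ℝ)) =
      ENNReal.ofReal R * ENNReal.ofReal (R ^ (-4 / 5 : ℝ)) := by
    rw [← ENNReal.ofReal_mul hR.le]
    nth_rw 2 [← Real.rpow_one R]
    rw [← Real.rpow_add hR]
    norm_num
  rw [h3, mul_assoc, ← mul_add] at h1
  have h4 := (ENNReal.mul_le_mul_iff_right (by simpa using hR) ENNReal.ofReal_ne_top).1 h1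
  refine h4.trans ?_
  rw [mul_add, mul_comm (ENNReal.ofReal (R ^ (-4 / 5 : ℝ)))]
  gcongr

/-- A Riesz potential of the Willmore density, squared. -/
lemma potential_sq_le : (∫⁻ z in puncDisk x R,
      ENNReal.ofReal (distSq z x ^ (-2 / 5 : ℝ) * willmoreDensity f z)) ^ 2 ≤
    (∫⁻ z in puncDisk x R, ENNReal.ofReal (willmoreDensity f z)) *
      ∫⁻ z in puncDisk x R, ENNReal.ofReal (distSq z x ^ (-4 / 5 : ℝ) * willmoreDensity f z) := by
  have hwc := hf.continuousOn_willmoreDensity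
  have hm := (isOpen_puncDisk (x := x) (R := R)).measurableSet
  refine lintegral_ofReal_sq_le hm (hwc.aemeasurable hm)
    (((continuousOn_distSq_rpow x R _).mul hwc).aemeasurable hm)
    (fun z _ => willmoreDensity_nonneg f z) fun z hz => le_of_eq ?_
  have h1 : (distSq z x ^ (-2 / 5 : ℝ)) ^ 2 = distSq z x ^ (-4 / 5 : ℝ) := by
    have hz0 : 0 < distSq z x := hz.1
    rw [← Real.rpow_natCast, ← Real.rpow_mul hz0.le]
    norm_num
  rw [mul_pow, h1]
  ring

end IsConformalPuncture

end

section

variable {F : Type*} [NormedAddCommGroup F] [InnerProductSpace ℝ F]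
  {f : ℝ × ℝ → F} {x y c : ℝ × ℝ} {R r s t : ℝ}

lemma distSq_comm (x y : ℝ × ℝ) : distSq x y = distSq y x := by
  unfold distSq; ring

lemma distSq_nonneg (x y : ℝ × ℝ) : 0 ≤ distSq x y := by
  unfold distSq; positivity

/-- The triangle inequality. -/
lemma distSq_bounds (ht : 0 ≤ t) (hs : 0 ≤ s) (hx : distSq x c = t ^ 2) (hy : distSq y x = s ^ 2) :
    (t - s) ^ 2 ≤ distSq y c ∧ distSq y c ≤ (t + s) ^ 2 := by
  unfold distSq at *
  set a := x.1 - c.1 with ha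
  set b := x.2 - c.2 with hb
  have e1 : y.1 - c.1 = (y.1 - x.1) + a := by rw [ha]; ring
  have e2 : y.2 - c.2 = (y.2 - x.2) + b := by rw [hb]; ring
  rw [e1, e2]
  set p := y.1 - x.1
  set q := y.2 - x.2
  have h : |p * a + q * b| ≤ t * s := by
    apply abs_le_of_sq_le_sq _ (by positivity)
    nlinarith [sq_nonneg (p * b - q * a)]
  have := abs_le.1 h
  constructor <;> nlinarith

lemma puncDisk_subset (hx : distSq x c = t ^ 2) (hrt : r ≤ t) (htr : t + r ≤ R) (hr : 0 < r) :
    puncDisk x r ⊆ puncDisk c R := by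
  intro y hy
  have hy0 : 0 ≤ distSq y x := distSq_nonneg _ _
  have hs : √(distSq y x) < r := (Real.sqrt_lt' hr).2 hy.2
  have hs0 := Real.sqrt_nonneg (distSq y x)
  obtain ⟨h1, h2⟩ := distSq_bounds (by linarith) hs0 hx (Real.sq_sqrt hy0).symm
  refine ⟨lt_of_lt_of_le ?_ h1, lt_of_le_of_lt h2 ?_⟩
  · have : 0 < t - √(distSq y x) := by linarith
    positivity
  · exact pow_lt_pow_left₀ (by linarith) (by linarith) two_ne_zero

lemma lintegral_distSq_rpow (x : ℝ × ℝ) (hR : 0 ≤ R) (β : ℝ) :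
    ∫⁻ z in puncDisk x R, ENNReal.ofReal (distSq z x ^ β) =
      ∫⁻ t in Ioo 0 R, ENNReal.ofReal (t ^ (1 + 2 * β) * (2 * π)) := by
  have h := lintegral_puncDisk_rpow (u := fun _ => 1) (x := x) hR continuousOn_const
    (fun _ _ => zero_le_one) β
  simp only [mul_one] at h
  rw [h]
  simp [circleInt, two_mul]

lemma lintegral_rpow_mul_lt_top {β : ℝ} (hβ : -1 < β) (C : ℝ) :
    ∫⁻ t in Ioo 0 R, ENNReal.ofReal (t ^ β * C) < ⊤ := by
  have h : IntegrableOn (fun t : ℝ => t ^ β * C) (Ioo 0 R) := by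
    rcases le_or_gt R 0 with hR | hR
    · rw [Ioo_eq_empty (not_lt.2 hR)]; exact integrableOn_empty
    · exact ((intervalIntegral.integrableOn_Ioo_rpow_iff hR).2 hβ).mul_const C
  exact (lintegral_mono fun t => Real.ofReal_le_enorm _).trans_lt h.2

/-- Riesz kernels have uniformly bounded integrals. -/
lemma lintegral_distSq_rpow_le (hR : 0 < R) {z : ℝ × ℝ} (hz : z ∈ puncDisk c R) (β : ℝ) :
    ∫⁻ x in puncDisk c R, ENNReal.ofReal (distSq z x ^ β) ≤
      ∫⁻ t in Ioo 0 (2 * R), ENNReal.ofReal (t ^ (1 + 2 * β) * (2 * π)) := by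
  rw [← lintegral_distSq_rpow z (by positivity)]
  simp only [distSq_comm z]
  refine lintegral_mono_set' ?_
  have h0 : ∀ᵐ w : ℝ × ℝ, w ≠ z := by
    simp [ae_iff, measure_singleton]
  filter_upwards [h0] with w hw hwc
  change w ∈ puncDisk z (2 * R)
  have hwc' : w ∈ puncDisk c R := hwc
  refine ⟨?_, ?_⟩
  · rcases eq_or_ne w.1 z.1 with h | h
    · have h2 : w.2 - z.2 ≠ 0 := fun h2 => hw (Prod.ext h (sub_eq_zero.1 h2))
      positivity
    · have h2 : w.1 - z.1 ≠ 0 := sub_ne_zero.2 h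
      positivity
  · have h1 := hwc'.2
    have h2 := hz.2
    nlinarith [sq_nonneg (w.1 - c.1 + (z.1 - c.1)), sq_nonneg (w.2 - c.2 + (z.2 - c.2))]

namespace IsConformalPuncture

variable (hf : IsConformalPuncture f c R)
include hf

lemma at_point (hx : distSq x c = t ^ 2) (hrt : r ≤ t) (htr : t + r ≤ R) (hr : 0 < r) :
    IsConformalPuncture f x r := by
  have hs := puncDisk_subset hx hrt htr hr
  exact ⟨hr, hf.smooth.mono hs, fun z hz => hf.norm_eq z (hs hz), fun z hz => hf.inner_eq z (hs hz),
    fun z hz => hf.energy_pos z (hs hz), hf.energy_int.mono_set hs, hf.willmore_int.mono_set hs⟩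

lemma lintegral_energy_potential_lt_top [CompleteSpace F]
    (hW : ∫ z in puncDisk c R, willmoreDensity f z ≤ 1 / 10 ^ 7) (hr : r ∈ Ioo 0 R) :
    ∫⁻ z in puncDisk c r, ENNReal.ofReal (distSq z c ^ (-3 / 5 : ℝ) * energyDensity f z) < ⊤ := by
  rw [lintegral_puncDisk_rpow hr.1.le
    (hf.mono hr.1 hr.2.le).continuousOn_energyDensity (fun z _ => energyDensity_nonneg f z),
    show (1 + 2 * (-3 / 5) : ℝ) = -1 / 5 by norm_num]
  exact (hf.lintegral_circle_le hW hr).trans_lt ENNReal.ofReal_lt_top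

/-- The energy potential at a regular point is controlled by the one at the puncture. -/
lemma lintegral_circle_at_point_le [CompleteSpace F]
    (hW : ∫ z in puncDisk c R, willmoreDensity f z ≤ 1 / 10 ^ 7) (ht : 0 < t) (htR : 2 * t < R)
    (hx : distSq x c = t ^ 2) :
    ∫⁻ s in Ioo 0 (t / 2), ENNReal.ofReal (s ^ (-1 / 5 : ℝ) * circleInt x (energyDensity f) s) ≤
      225 * ∫⁻ z in puncDisk c (3 * R / 4),
        ENNReal.ofReal (distSq z c ^ (-3 / 5 : ℝ) * energyDensity f z) := by
  have hft := hf.at_point hx le_rfl (by linarith) ht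
  have hρ : 0 < t / 2 := by positivity
  have hWt : ∫ z in puncDisk x t, willmoreDensity f z ≤ 1 / 10 ^ 7 :=
    (setIntegral_mono_set hf.willmore_int (ae_of_all _ (willmoreDensity_nonneg f))
      (puncDisk_subset hx le_rfl (by linarith) ht).eventuallyLE).trans hW
  refine (hft.lintegral_circle_le hWt ⟨hρ, by linarith⟩).trans ?_
  have hint : Integrable (energyDensity f) (volume.restrict (puncDisk x (t / 2))) :=
    (hft.mono hρ (by linarith)).energy_int
  rw [← mul_assoc, ENNReal.ofReal_mul (by positivity),
    ofReal_integral_eq_lintegral_ofReal hint (ae_of_all _ (energyDensity_nonneg f)),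
    ← lintegral_const_mul' _ _ ENNReal.ofReal_ne_top, ← lintegral_const_mul' _ _ (by simp)]
  have hsub : puncDisk x (t / 2) ⊆ puncDisk c (3 * R / 4) :=
    puncDisk_subset hx (by linarith) (by linarith) hρ
  refine (setLIntegral_mono' isOpen_puncDisk.measurableSet fun z hz => ?_).trans
    (lintegral_mono_set hsub)
  have hsub3 : puncDisk x (t / 2) ⊆ puncDisk c (3 * (t / 2)) :=
    puncDisk_subset hx (by linarith) (by linarith) hρ
  have hz0 : 0 < distSq z c := (hsub3 hz).1
  have hz3 : distSq z c ≤ (3 * (t / 2)) ^ 2 := (hsub3 hz).2.le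
  have h1 : (t / 2) ^ (-6 / 5 : ℝ) ≤ 9 * distSq z c ^ (-3 / 5 : ℝ) := by
    have h2 : ((3 * (t / 2)) ^ 2) ^ (-3 / 5 : ℝ) ≤ distSq z c ^ (-3 / 5 : ℝ) :=
      Real.rpow_le_rpow_of_nonpos hz0 hz3 (by norm_num)
    have h3 : ((3 * (t / 2)) ^ 2) ^ (-3 / 5 : ℝ) =
        (9 : ℝ) ^ (-3 / 5 : ℝ) * (t / 2) ^ (-6 / 5 : ℝ) := by
      rw [mul_pow, Real.mul_rpow (by positivity) (by positivity), ← Real.rpow_natCast (t / 2),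
        ← Real.rpow_mul hρ.le]
      norm_num
    have h4 : (9 : ℝ) ^ (-1 : ℝ) ≤ (9 : ℝ) ^ (-3 / 5 : ℝ) :=
      Real.rpow_le_rpow_of_exponent_le (by norm_num) (by norm_num)
    rw [Real.rpow_neg_one] at h4
    have h5 := mul_le_mul_of_nonneg_right h4 (Real.rpow_nonneg hρ.le (-6 / 5 : ℝ))
    linarith
  rw [← ENNReal.ofReal_mul (by positivity), show (225 : ℝ≥0∞) = ENNReal.ofReal 225 by simp,
    ← ENNReal.ofReal_mul (by positivity)]
  apply ENNReal.ofReal_le_ofReal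
  nlinarith [mul_le_mul_of_nonneg_right h1 (energyDensity_nonneg f z)]

lemma energyDensity_sq_le [CompleteSpace F]
    (hW : ∫ z in puncDisk c R, willmoreDensity f z ≤ 1 / 10 ^ 7) (hx : x ∈ puncDisk c (R / 2)) :
    ENNReal.ofReal (energyDensity f x) ^ 2 ≤
      (225 * ∫⁻ z in puncDisk c (3 * R / 4),
        ENNReal.ofReal (distSq z c ^ (-3 / 5 : ℝ) * energyDensity f z)) ^ 2 *
      (8 * ENNReal.ofReal (distSq x c ^ (-4 / 5 : ℝ)) +
        2 * ((∫⁻ z in puncDisk c R, ENNReal.ofReal (willmoreDensity f z)) *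
          ∫⁻ z in puncDisk c R,
            ENNReal.ofReal (distSq z x ^ (-4 / 5 : ℝ) * willmoreDensity f z))) := by
  have hR := hf.pos
  set t := √(distSq x c) with htdef
  have hx0 : 0 < distSq x c := hx.1
  have ht : 0 < t := Real.sqrt_pos.2 hx0
  have hxt : distSq x c = t ^ 2 := (Real.sq_sqrt hx0.le).symm
  have htR : t < R / 2 := (Real.sqrt_lt' (by positivity)).2 hx.2
  have hρ : 0 < t / 2 := by positivity
  have hfρ := hf.at_point (r := t / 2) hxt (by linarith) (by linarith) hρ
  have hxR : x ∈ puncDisk c R := puncDisk_mono (by positivity) (by linarith) hx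
  have hnhds := (isOpen_puncDisk (x := c) (R := R)).mem_nhds hxR
  have hpot := hfρ.energyDensity_le_potential
    (hf.contDiffOn_dx.continuousOn.continuousAt hnhds)
    (hf.contDiffOn_dy.continuousOn.continuousAt hnhds)
  have hK := hf.lintegral_circle_at_point_le hW ht (by linarith) hxt
  have hsub : puncDisk x (t / 2) ⊆ puncDisk c R :=
    puncDisk_subset hxt (by linarith) (by linarith) hρ
  refine (pow_le_pow_left' (hpot.trans (mul_le_mul_left hK _)) 2).trans ?_
  rw [mul_pow]
  refine mul_le_mul_right ((ENNReal_add_sq_le _ _).trans (add_le_add ?_ ?_)) _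
  · rw [← ENNReal.ofReal_pow (by positivity), show (8 : ℝ≥0∞) = 2 * ENNReal.ofReal 4 by
      rw [show (2 : ℝ≥0∞) = ENNReal.ofReal 2 by simp, ← ENNReal.ofReal_mul (by norm_num)]; norm_num,
      mul_assoc, ← ENNReal.ofReal_mul (by norm_num)]
    refine mul_le_mul_right (ENNReal.ofReal_le_ofReal ?_) _
    rw [hxt, div_eq_mul_inv, Real.mul_rpow ht.le (by norm_num), mul_pow]
    have e1 : (t ^ (-4 / 5 : ℝ)) ^ 2 = (t ^ 2) ^ (-4 / 5 : ℝ) := by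
      rw [← Real.rpow_natCast, ← Real.rpow_natCast, ← Real.rpow_mul ht.le, ← Real.rpow_mul ht.le]
      norm_num
    have e2 : (((2 : ℝ)⁻¹) ^ (-4 / 5 : ℝ)) ^ 2 ≤ 4 := by
      have : ((2 : ℝ)⁻¹) ^ (-4 / 5 : ℝ) ≤ 2 := by
        rw [Real.inv_rpow (by norm_num), ← Real.rpow_neg (by norm_num)]
        nth_rw 2 [← Real.rpow_one 2]
        exact Real.rpow_le_rpow_of_exponent_le (by norm_num) (by norm_num)
      have h0 : 0 ≤ ((2 : ℝ)⁻¹) ^ (-4 / 5 : ℝ) := by positivity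
      nlinarith
    rw [e1, mul_comm (4 : ℝ)]
    exact mul_le_mul_of_nonneg_left e2 (by positivity)
  · refine mul_le_mul_right (hfρ.potential_sq_le.trans ?_) _
    gcongr

/-- The energy density is square integrable near the puncture. -/
lemma lintegral_energyDensity_sq_lt_top [CompleteSpace F]
    (hW : ∫ z in puncDisk c R, willmoreDensity f z ≤ 1 / 10 ^ 7) :
    ∫⁻ x in puncDisk c (R / 2), ENNReal.ofReal (energyDensity f x) ^ 2 < ⊤ := by
  have hR := hf.pos
  have hm := (isOpen_puncDisk (x := c) (R := R)).measurableSet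
  refine (setLIntegral_mono' isOpen_puncDisk.measurableSet fun x hx =>
    hf.energyDensity_sq_le hW hx).trans_lt ?_
  have hK := hf.lintegral_energy_potential_lt_top hW (r := 3 * R / 4)
    ⟨by positivity, by linarith⟩
  have hWt : ∫⁻ z in puncDisk c R, ENNReal.ofReal (willmoreDensity f z) < ⊤ :=
    (lintegral_mono fun t => Real.ofReal_le_enorm _).trans_lt hf.willmore_int.2
  rw [lintegral_const_mul' _ _ (ENNReal.pow_ne_top (ENNReal.mul_ne_top (by simp) hK.ne))]
  refine ENNReal.mul_lt_top (ENNReal.pow_lt_top (ENNReal.mul_lt_top (by simp) hK)) ?_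
  have hmeas : Measurable fun x => 8 * ENNReal.ofReal (distSq x c ^ (-4 / 5 : ℝ)) :=
    (((continuous_distSq c).measurable.pow_const _).ennreal_ofReal).const_mul _
  rw [lintegral_add_left hmeas, lintegral_const_mul' _ _ (by simp),
    lintegral_const_mul' _ _ (by simp), lintegral_const_mul' _ _ hWt.ne,
    lintegral_distSq_rpow c (by positivity)]
  refine ENNReal.add_lt_top.2 ⟨ENNReal.mul_lt_top (by simp)
    (lintegral_rpow_mul_lt_top (by norm_num) _), ENNReal.mul_lt_top (by simp)
    (ENNReal.mul_lt_top hWt ?_)⟩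
  refine (lintegral_mono_set (puncDisk_mono (by positivity)
    (by linarith : R / 2 ≤ R))).trans_lt ?_
  have hker : AEMeasurable (Function.uncurry fun x z : ℝ × ℝ =>
      ENNReal.ofReal (distSq z x ^ (-4 / 5 : ℝ) * willmoreDensity f z))
      ((volume.restrict (puncDisk c R)).prod (volume.restrict (puncDisk c R))) := by
    have h1 : Measurable fun p : (ℝ × ℝ) × (ℝ × ℝ) => distSq p.2 p.1 ^ (-4 / 5 : ℝ) := by
      have : Continuous fun p : (ℝ × ℝ) × (ℝ × ℝ) => distSq p.2 p.1 := by
        unfold distSq; fun_prop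
      exact this.measurable.pow_const _
    exact (h1.aemeasurable.mul
      (hf.continuousOn_willmoreDensity.aemeasurable hm).comp_snd).ennreal_ofReal
  rw [lintegral_lintegral_swap hker]
  set C := ∫⁻ t in Ioo 0 (2 * R), ENNReal.ofReal (t ^ (1 + 2 * (-4 / 5) : ℝ) * (2 * π)) with hC
  have hCt : C < ⊤ := lintegral_rpow_mul_lt_top (by norm_num) _
  refine (setLIntegral_mono' (g := fun z => C * ENNReal.ofReal (willmoreDensity f z)) hm
    fun z hz => ?_).trans_lt ?_
  · simp only [ENNReal.ofReal_mul (Real.rpow_nonneg (distSq_nonneg _ _) _)]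
    rw [lintegral_mul_const' _ _ ENNReal.ofReal_ne_top]
    exact mul_le_mul_left (lintegral_distSq_rpow_le hR hz _) _
  · rw [lintegral_const_mul' _ _ hCt.ne]
    exact ENNReal.mul_lt_top hCt hWt

end IsConformalPuncture

end

lemma puncDisk_subset_closedBall (c : ℝ × ℝ) (R : ℝ) :
    puncDisk c R ⊆ Metric.closedBall c |R| := by
  intro z hz
  rw [Metric.mem_closedBall, Prod.dist_eq, max_le_iff, Real.dist_eq, Real.dist_eq]
  have h := hz.2
  exact ⟨sq_le_sq.1 (by nlinarith [sq_nonneg (z.2 - c.2)]),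
    sq_le_sq.1 (by nlinarith [sq_nonneg (z.1 - c.1)])⟩

lemma volume_puncDisk_lt_top (c : ℝ × ℝ) (R : ℝ) : volume (puncDisk c R) < ⊤ :=
  (Metric.isBounded_closedBall.subset (puncDisk_subset_closedBall c R)).measure_lt_top

/-- Interpolation between the Willmore density and the squared energy density. -/
lemma rpow_le_of_sq_eq {l w e p : ℝ} (hl : 0 ≤ l) (hw : 0 ≤ w)
    (h : l ^ 2 = w * e) (hp0 : 0 ≤ p) (hp : p ≤ 4 / 3) : l ^ p ≤ w + e ^ 2 + 1 := by
  set M := w + e ^ 2 + 1 with hM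
  have hM1 : 1 ≤ M := by nlinarith [sq_nonneg e]
  have hM0 : 0 ≤ M := by linarith
  have h4 : l ^ 4 ≤ M ^ 3 := by
    calc l ^ 4 = w ^ 2 * e ^ 2 := by rw [← mul_pow, ← h]; ring
      _ ≤ M ^ 2 * M := mul_le_mul (pow_le_pow_left₀ hw (by nlinarith [sq_nonneg e]) 2)
          (by linarith) (sq_nonneg e) (sq_nonneg M)
      _ = M ^ 3 := by ring
  calc l ^ p = (l ^ 4) ^ (p / 4) := by
        rw [← Real.rpow_natCast l, ← Real.rpow_mul hl]; congr 1; push_cast; ring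
    _ ≤ (M ^ 3) ^ (p / 4) := Real.rpow_le_rpow (by positivity) h4 (by positivity)
    _ = M ^ (3 * p / 4) := by
        rw [← Real.rpow_natCast M, ← Real.rpow_mul hM0]; congr 1; push_cast; ring
    _ ≤ M ^ (1 : ℝ) := Real.rpow_le_rpow_of_exponent_le hM1 (by linarith)
    _ = M := Real.rpow_one M

namespace IsConformalPuncture

variable {F : Type*} [NormedAddCommGroup F] [InnerProductSpace ℝ F]
  {f : ℝ × ℝ → F} {c : ℝ × ℝ} {R r : ℝ} (hf : IsConformalPuncture f c R)
include hf

lemma exists_willmore_le {ε : ℝ} (hε : 0 < ε) :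
    ∃ r, 0 < r ∧ r ≤ R ∧ ∫ z in puncDisk c r, willmoreDensity f z ≤ ε := by
  have hR := hf.pos
  have hk : ∀ k : ℕ, 0 < R / (k + 1) ∧ R / (k + 1) ≤ R := fun k =>
    ⟨by positivity, div_le_self hR.le (by linarith [k.cast_nonneg (α := ℝ)])⟩
  have hanti : Antitone fun k : ℕ => puncDisk c (R / (k + 1)) := fun i j hij =>
    puncDisk_mono (hk j).1.le (by gcongr)
  have hlim := tendsto_setIntegral_of_antitone (f := willmoreDensity f) (μ := volume)
    (fun k : ℕ => (isOpen_puncDisk (x := c) (R := R / (k + 1))).measurableSet) hanti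
    ⟨0, by simpa using hf.willmore_int⟩
  have hempty : ⋂ k : ℕ, puncDisk c (R / (k + 1)) = ∅ := by
    refine eq_empty_of_forall_notMem fun z hz => ?_
    rw [mem_iInter] at hz
    have h0 : 0 < distSq z c := (hz 0).1
    have hl : Tendsto (fun k : ℕ => (R / ((k : ℝ) + 1)) ^ 2) atTop (𝓝 0) := by
      have := (tendsto_one_div_add_atTop_nhds_zero_nat (𝕜 := ℝ)).const_mul R
      simpa [div_eq_mul_inv] using this.pow 2
    obtain ⟨k, hk⟩ := (hl.eventually_lt_const h0).exists
    exact lt_irrefl _ (hk.trans (hz k).2)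
  rw [hempty, setIntegral_empty] at hlim
  obtain ⟨k, hk'⟩ := (hlim.eventually_lt_const hε).exists
  exact ⟨_, (hk k).1, (hk k).2, hk'.le⟩

/-- A conformal immersion of finite energy and Willmore energy extends across the puncture. -/
lemma exists_tendsto [CompleteSpace F] : ∃ L, Tendsto f (𝓝[puncDisk c R] c) (𝓝 L) := by
  obtain ⟨R₀, hR₀, hR₀R, hW⟩ := hf.exists_willmore_le (ε := 1 / 32) (by norm_num)
  have hf₀ := hf.mono hR₀ hR₀R
  rcases (𝓝[puncDisk c R] c).eq_or_neBot with hbot | hne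
  · exact ⟨0, by rw [hbot]; exact tendsto_bot⟩
  apply cauchy_map_iff_exists_tendsto.1
  rw [Metric.cauchy_iff]
  refine ⟨inferInstance, fun ε hε => ?_⟩
  obtain ⟨r, hr, hr2⟩ := exists_sq_mul_lt hR₀ hf₀.energy_circle_int
    (ε := (ε / 2) ^ 2 / 1300) (by positivity)
  obtain ⟨p, hp, -⟩ := hf₀.exists_center hr.1 hr.2 hW
  have hclose : ∀ z ∈ puncDisk c r, ‖f z - p‖ < ε / 2 := fun z hz => by
    refine lt_of_pow_lt_pow_left₀ 2 (by positivity) ((hp z hz).trans_lt ?_)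
    linarith
  refine ⟨f '' puncDisk c r, image_mem_map ?_, ?_⟩
  · have h1 : {z | distSq z c < r ^ 2} ∈ 𝓝 c :=
      (isOpen_lt (continuous_distSq c) continuous_const).mem_nhds (by
        simpa [distSq] using pow_pos hr.1 2)
    filter_upwards [mem_nhdsWithin_of_mem_nhds h1, self_mem_nhdsWithin] with z hz1 hz2
    exact ⟨hz2.1, hz1⟩
  · rintro _ ⟨z, hz, rfl⟩ _ ⟨w, hw, rfl⟩
    calc dist (f z) (f w) ≤ dist (f z) p + dist (f w) p := dist_triangle_right _ _ _
      _ < ε / 2 + ε / 2 := by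
        rw [dist_eq_norm, dist_eq_norm]; exact add_lt_add (hclose z hz) (hclose w hw)
      _ = ε := add_halves ε

/-- Higher integrability of the Laplacian near the puncture. -/
lemma lintegral_laplace_rpow_lt_top [CompleteSpace F] (hr0 : 0 ≤ r) (hrR : r < R) {p : ℝ}
    (hp0 : 0 ≤ p) (hp : p ≤ 4 / 3) :
    ∫⁻ z in puncDisk c r, ENNReal.ofReal (‖laplace f z‖ ^ p) < ⊤ := by
  have hR := hf.pos
  obtain ⟨R₀, hR₀, hR₀R, hW⟩ := hf.exists_willmore_le (ε := 1 / 10 ^ 7) (by norm_num)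
  have hf₀ := hf.mono hR₀ hR₀R
  set K : Set (ℝ × ℝ) := {z | (R₀ / 2) ^ 2 ≤ distSq z c ∧ distSq z c ≤ r ^ 2} ∩
    Metric.closedBall c |R| with hK
  have hKc : IsCompact K := (isCompact_closedBall c |R|).inter_left
    ((isClosed_le continuous_const (continuous_distSq c)).inter
      (isClosed_le (continuous_distSq c) continuous_const))
  have hsub : puncDisk c r ⊆ puncDisk c (R₀ / 2) ∪ K := fun z hz => by
    rcases lt_or_ge (distSq z c) ((R₀ / 2) ^ 2) with h | h
    · exact Or.inl ⟨hz.1, h⟩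
    · exact Or.inr ⟨⟨h, hz.2.le⟩,
        puncDisk_subset_closedBall c R (puncDisk_mono hr0 hrR.le hz)⟩
  have hKR : K ⊆ puncDisk c R := fun z hz =>
    ⟨lt_of_lt_of_le (by positivity) hz.1.1,
      lt_of_le_of_lt hz.1.2 (pow_lt_pow_left₀ hrR hr0 two_ne_zero)⟩
  refine (lintegral_mono_set hsub).trans_lt ((lintegral_union_le _ _ _).trans_lt
    (ENNReal.add_lt_top.2 ⟨?_, ?_⟩))
  · have hf₁ := hf₀.mono (r := R₀ / 2) (by positivity) (by linarith)
    have hb : ∀ z ∈ puncDisk c (R₀ / 2), ENNReal.ofReal (‖laplace f z‖ ^ p) ≤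
        ENNReal.ofReal (willmoreDensity f z) + (ENNReal.ofReal (energyDensity f z) ^ 2 + 1) := by
      intro z hz
      rw [← ENNReal.ofReal_pow (energyDensity_nonneg f z), ← ENNReal.ofReal_one,
        ← ENNReal.ofReal_add (sq_nonneg _) zero_le_one,
        ← ENNReal.ofReal_add (willmoreDensity_nonneg f z) (by positivity), ← add_assoc]
      exact ENNReal.ofReal_le_ofReal (rpow_le_of_sq_eq (norm_nonneg _) (willmoreDensity_nonneg f z)
        (hf₁.norm_laplace_sq hz) hp0 hp)
    refine (setLIntegral_mono' isOpen_puncDisk.measurableSet hb).trans_lt ?_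
    rw [lintegral_add_left' (hf₁.continuousOn_willmoreDensity.aemeasurable
      isOpen_puncDisk.measurableSet).ennreal_ofReal, lintegral_add_right _ measurable_const,
      setLIntegral_const, one_mul]
    exact ENNReal.add_lt_top.2 ⟨(lintegral_mono fun t => Real.ofReal_le_enorm _).trans_lt
      hf₁.willmore_int.2, ENNReal.add_lt_top.2 ⟨hf₀.lintegral_energyDensity_sq_lt_top hW,
      volume_puncDisk_lt_top _ _⟩⟩
  · have hc : ContinuousOn (fun z => ‖laplace f z‖ ^ p) K :=
      ((continuousOn_laplace isOpen_puncDisk hf.smooth).norm.rpow_const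
        fun _ _ => Or.inr hp0).mono hKR
    exact (lintegral_mono fun t => Real.ofReal_le_enorm _).trans_lt
      (hc.integrableOn_compact hKc).2

end IsConformalPuncture

section

variable {F G : Type*} [NormedAddCommGroup F] [InnerProductSpace ℝ F]
  [NormedAddCommGroup G] [InnerProductSpace ℝ G]

lemma fderiv_toLp {u : ℝ × ℝ → F} {v : ℝ × ℝ → G} {z : ℝ × ℝ} (hu : DifferentiableAt ℝ u z)
    (hv : DifferentiableAt ℝ v z) (e : ℝ × ℝ) :
    fderiv ℝ (fun w => WithLp.toLp 2 (u w, v w)) z e =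
      WithLp.toLp 2 (fderiv ℝ u z e, fderiv ℝ v z e) := by
  have h := ((WithLp.prodContinuousLinearEquiv 2 ℝ F G).symm :
    F × G →L[ℝ] WithLp 2 (F × G)).hasFDerivAt.comp z (hu.hasFDerivAt.prodMk hv.hasFDerivAt)
  exact congrArg (fun L => L e) h.fderiv

/-- The graph of a map on the plane. -/
noncomputable def graphMap (f : ℝ × ℝ → F) (z : ℝ × ℝ) : WithLp 2 (F × WithLp 2 (ℝ × ℝ)) :=
  WithLp.toLp 2 (f z, WithLp.toLp 2 z)

lemma hasFDerivAt_toLp (z : ℝ × ℝ) : HasFDerivAt (fun w : ℝ × ℝ => WithLp.toLp 2 w)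
    ((WithLp.prodContinuousLinearEquiv 2 ℝ ℝ ℝ).symm : ℝ × ℝ →L[ℝ] WithLp 2 (ℝ × ℝ)) z :=
  ((WithLp.prodContinuousLinearEquiv 2 ℝ ℝ ℝ).symm : ℝ × ℝ →L[ℝ] WithLp 2 (ℝ × ℝ)).hasFDerivAt

lemma fderiv_graphMap {f : ℝ × ℝ → F} {z : ℝ × ℝ} (hf : DifferentiableAt ℝ f z) (e : ℝ × ℝ) :
    fderiv ℝ (graphMap f) z e = WithLp.toLp 2 (fderiv ℝ f z e, WithLp.toLp 2 e) := by
  refine (fderiv_toLp hf (hasFDerivAt_toLp z).differentiableAt e).trans ?_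
  rw [(hasFDerivAt_toLp z).fderiv]
  rfl

variable {f : ℝ × ℝ → F} {s : Set (ℝ × ℝ)} {z : ℝ × ℝ}

omit [InnerProductSpace ℝ F] [InnerProductSpace ℝ G] in
lemma norm_toLp_sq (a : F) (b : G) : ‖WithLp.toLp 2 (a, b)‖ ^ 2 = ‖a‖ ^ 2 + ‖b‖ ^ 2 :=
  WithLp.prod_norm_sq_eq_of_L2 _

lemma norm_dx_graphMap_sq (hf : DifferentiableAt ℝ f z) :
    ‖dx (graphMap f) z‖ ^ 2 = ‖dx f z‖ ^ 2 + 1 := by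
  unfold dx
  rw [fderiv_graphMap hf, norm_toLp_sq, norm_toLp_sq]
  simp

lemma norm_dy_graphMap_sq (hf : DifferentiableAt ℝ f z) :
    ‖dy (graphMap f) z‖ ^ 2 = ‖dy f z‖ ^ 2 + 1 := by
  unfold dy
  rw [fderiv_graphMap hf, norm_toLp_sq, norm_toLp_sq]
  simp

lemma energyDensity_graphMap (hf : DifferentiableAt ℝ f z) :
    energyDensity (graphMap f) z = energyDensity f z + 2 := by
  unfold energyDensity
  rw [norm_dx_graphMap_sq hf, norm_dy_graphMap_sq hf]
  ring

lemma inner_graphMap (hf : DifferentiableAt ℝ f z) :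
    ⟪dx (graphMap f) z, dy (graphMap f) z⟫ = ⟪dx f z, dy f z⟫ := by
  unfold dx dy
  rw [fderiv_graphMap hf, fderiv_graphMap hf, WithLp.prod_inner_apply, WithLp.prod_inner_apply]
  simp

lemma fderiv_fderiv_graphMap (hs : IsOpen s) (hf : ContDiffOn ℝ 2 f s) (hz : z ∈ s) (e : ℝ × ℝ) :
    fderiv ℝ (fun w => fderiv ℝ (graphMap f) w e) z e =
      WithLp.toLp 2 (fderiv ℝ (fun w => fderiv ℝ f w e) z e, 0) := by
  have heq : (fun w => fderiv ℝ (graphMap f) w e) =ᶠ[𝓝 z]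
      fun w => WithLp.toLp 2 (fderiv ℝ f w e, WithLp.toLp 2 e) := by
    filter_upwards [hs.mem_nhds hz] with w hw
    exact fderiv_graphMap ((hf.differentiableOn two_ne_zero).differentiableAt (hs.mem_nhds hw)) e
  have hd : ContDiffOn ℝ 1 (fun w => fderiv ℝ f w e) s :=
    (hf.fderiv_of_isOpen hs (by norm_num)).clm_apply contDiffOn_const
  rw [heq.fderiv_eq, fderiv_toLp ((hd.differentiableOn one_ne_zero).differentiableAt
    (hs.mem_nhds hz)) (differentiableAt_const _)]
  simp

lemma norm_laplace_graphMap (hs : IsOpen s) (hf : ContDiffOn ℝ 2 f s) (hz : z ∈ s) :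
    ‖laplace (graphMap f) z‖ = ‖laplace f z‖ := by
  have h : laplace (graphMap f) z = WithLp.toLp 2 (laplace f z, 0) := by
    have h1 := fderiv_fderiv_graphMap hs hf hz (1, 0)
    have h2 := fderiv_fderiv_graphMap hs hf hz (0, 1)
    unfold laplace dx dy
    rw [h1, h2, ← WithLp.toLp_add]
    simp
  rw [← sq_eq_sq₀ (norm_nonneg _) (norm_nonneg _), h, norm_toLp_sq]
  simp

lemma contDiffOn_graphMap {k : WithTop ℕ∞} (hf : ContDiffOn ℝ k f s) :
    ContDiffOn ℝ k (graphMap f) s :=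
  (WithLp.prodContinuousLinearEquiv 2 ℝ F (WithLp 2 (ℝ × ℝ))).symm.contDiff.comp_contDiffOn
    (hf.prodMk (WithLp.prodContinuousLinearEquiv 2 ℝ ℝ ℝ).symm.contDiff.contDiffOn)

/-- Adding the identity as further components turns a weakly conformal map whose Laplacian vanishes
at its branch points into a conformal immersion, without increasing the Willmore energy. -/
lemma isConformalPuncture_graphMap {c : ℝ × ℝ} {R : ℝ} (hR : 0 < R)
    (hsm : ContDiffOn ℝ 2 f (puncDisk c R))
    (hn : ∀ z ∈ puncDisk c R, ‖dx f z‖ ^ 2 = ‖dy f z‖ ^ 2)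
    (hi : ∀ z ∈ puncDisk c R, ⟪dx f z, dy f z⟫ = 0)
    (hH : ∀ z ∈ puncDisk c R, energyDensity f z = 0 → laplace f z = 0)
    (hE : ∫⁻ z in puncDisk c R, ENNReal.ofReal (energyDensity f z) < ⊤)
    (hW : ∫⁻ z in puncDisk c R ∩ {w | energyDensity f w ≠ 0},
      ENNReal.ofReal (willmoreDensity f z) < ⊤) :
    IsConformalPuncture (graphMap f) c R := by
  have hs := isOpen_puncDisk (x := c) (R := R)
  have hsg := contDiffOn_graphMap hsm
  have hd : ∀ z ∈ puncDisk c R, DifferentiableAt ℝ f z := fun z hz =>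
    (hsm.differentiableOn two_ne_zero).differentiableAt (hs.mem_nhds hz)
  have hpos : ∀ z ∈ puncDisk c R, 0 < energyDensity (graphMap f) z := fun z hz => by
    rw [energyDensity_graphMap (hd z hz)]
    linarith [energyDensity_nonneg f z]
  have hfin : ∀ u : ℝ × ℝ → ℝ, ContinuousOn u (puncDisk c R) → (∀ z, 0 ≤ u z) →
      ∫⁻ z in puncDisk c R, ENNReal.ofReal (u z) < ⊤ → IntegrableOn u (puncDisk c R) :=
    fun u hu h0 hlt => ⟨hu.aestronglyMeasurable hs.measurableSet,
      (hasFiniteIntegral_iff_ofReal (ae_of_all _ h0)).2 hlt⟩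
  have hgc := continuousOn_energyDensity hs hsm
  refine ⟨hR, hsg, fun z hz => ?_, fun z hz => ?_, hpos, ?_, ?_⟩
  · rw [norm_dx_graphMap_sq (hd z hz), norm_dy_graphMap_sq (hd z hz), hn z hz]
  · rw [inner_graphMap (hd z hz), hi z hz]
  · have h1 := (hfin _ hgc (energyDensity_nonneg f) hE).add
      (integrableOn_const (C := (2 : ℝ)) (volume_puncDisk_lt_top c R).ne)
    exact h1.congr_fun (fun z hz => (energyDensity_graphMap (hd z hz)).symm) hs.measurableSet
  · refine hfin _ (((continuousOn_laplace hs hsg).norm.pow 2).div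
      (continuousOn_energyDensity hs hsg) fun z hz => (hpos z hz).ne')
      (willmoreDensity_nonneg _) ?_
    have hS : IsOpen (puncDisk c R ∩ {w | energyDensity f w ≠ 0}) :=
      hgc.isOpen_inter_preimage hs isOpen_compl_singleton
    set S := puncDisk c R ∩ {w | energyDensity f w ≠ 0} with hSdef
    have hle : ∀ z ∈ puncDisk c R, ENNReal.ofReal (willmoreDensity (graphMap f) z) ≤
        S.indicator (fun z => ENNReal.ofReal (willmoreDensity f z)) z := fun z hz => by
      unfold willmoreDensity
      rw [norm_laplace_graphMap hs hsm hz, energyDensity_graphMap (hd z hz)]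
      by_cases h0 : energyDensity f z = 0
      · simp [hH z hz h0]
      · rw [indicator_of_mem (show z ∈ S from ⟨hz, h0⟩)]
        have h1 : 0 < energyDensity f z := lt_of_le_of_ne' (energyDensity_nonneg f z) h0
        exact ENNReal.ofReal_le_ofReal
          (div_le_div_of_nonneg_left (sq_nonneg _) h1 (by linarith))
    refine (setLIntegral_mono' hs.measurableSet hle).trans_lt ?_
    rw [setLIntegral_indicator hS.measurableSet]
    exact (lintegral_mono_set inter_subset_left).trans_lt hW

lemma puncDisk_zero (R : ℝ) : puncDisk 0 R = disk R \ {0} := by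
  ext z
  have h : 0 < z.1 ^ 2 + z.2 ^ 2 ↔ z ≠ 0 := by
    rw [Ne, Prod.ext_iff, lt_iff_le_and_ne]
    refine ⟨fun h h' => h.2 (by simp [h'.1, h'.2]), fun h => ⟨by positivity, fun h' => h ⟨?_, ?_⟩⟩⟩
    · change z.1 = 0
      nlinarith [sq_nonneg z.1, sq_nonneg z.2]
    · change z.2 = 0
      nlinarith [sq_nonneg z.1, sq_nonneg z.2]
  simp only [puncDisk, disk, mem_ofPred_eq, Set.mem_sdiff, mem_singleton_iff, Prod.fst_zero,
    Prod.snd_zero, sub_zero, h]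
  tauto

end

end PuncturedDisk

/-- Removability of a point singularity (Proposition 2.4), regularity across the puncture. -/
theorem removable_singularity_regularity (n : ℕ) (f : ℝ × ℝ → EuclideanSpace ℝ (Fin n))
    (hsm : ContDiffOn ℝ (⊤ : ℕ∞) f (disk 1 \ {0}))
    (hbd : ∃ R : ℝ, ∀ z ∈ disk 1 \ {0}, ‖f z‖ ≤ R)
    (hconf : ∀ z ∈ disk 1 \ {0},
        ‖pd1 f z‖ ^ 2 = ‖pd2 f z‖ ^ 2 ∧ ⟪pd1 f z, pd2 f z⟫ = 0)
    (hH : ∀ z ∈ disk 1 \ {0}, fderiv ℝ f z = 0 → lap f z = 0)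
    (hE : ∫⁻ z in disk 1 \ {0}, ENNReal.ofReal (gradSq f z) < ⊤)
    (hW : willmore f (disk 1 \ {0}) < ⊤) :
    (∀ p' : ℝ, 1 < p' → p' < 4/3 →
        ∫⁻ z in disk (1/2) \ {0}, ENNReal.ofReal (‖lap f z‖ ^ p') < ⊤) ∧
    (∃ L : EuclideanSpace ℝ (Fin n), Filter.Tendsto f (nhdsWithin 0 (disk 1 \ {0})) (nhds L)) := by
  simp only [← PuncturedDisk.puncDisk_zero] at *
  have hsm2 : ContDiffOn ℝ 2 f (PuncturedDisk.puncDisk 0 1) :=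
    hsm.of_le (WithTop.coe_le_coe.2 (le_top : (2 : ℕ∞) ≤ ⊤))
  have hg : PuncturedDisk.IsConformalPuncture (PuncturedDisk.graphMap f) 0 1 := by
    refine PuncturedDisk.isConformalPuncture_graphMap one_pos hsm2 (fun z hz => (hconf z hz).1)
      (fun z hz => (hconf z hz).2) (fun z hz h0 => hH z hz ?_) hE hW
    have h1 : ‖PuncturedDisk.dx f z‖ ^ 2 + ‖PuncturedDisk.dy f z‖ ^ 2 = 0 := h0
    have h2 : PuncturedDisk.dx f z = 0 := by
      rw [← norm_eq_zero]; nlinarith [sq_nonneg ‖PuncturedDisk.dx f z‖,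
        sq_nonneg ‖PuncturedDisk.dy f z‖]
    have h3 : PuncturedDisk.dy f z = 0 := by
      rw [← norm_eq_zero]; nlinarith [sq_nonneg ‖PuncturedDisk.dx f z‖,
        sq_nonneg ‖PuncturedDisk.dy f z‖]
    refine ContinuousLinearMap.ext fun e => ?_
    rw [← Prod.mk.eta (p := e), PuncturedDisk.fderiv_apply_eq, h2, h3]
    simp
  refine ⟨fun p' hp1 hp2 => ?_, ?_⟩
  · have h := hg.lintegral_laplace_rpow_lt_top (r := 1 / 2) (by norm_num) (by norm_num)
      (by linarith : 0 ≤ p') hp2.le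
    refine lt_of_eq_of_lt (setLIntegral_congr_fun PuncturedDisk.isOpen_puncDisk.measurableSet
      fun z hz => ?_) h
    have hz1 := PuncturedDisk.puncDisk_mono (R' := 1) (by norm_num) (by norm_num) hz
    simp only [PuncturedDisk.norm_laplace_graphMap PuncturedDisk.isOpen_puncDisk hsm2 hz1]
    rfl
  · obtain ⟨L, hL⟩ := hg.exists_tendsto
    exact ⟨L.fst, ((WithLp.prod_continuous_ofLp 2 _ _).fst.tendsto L).comp hL⟩
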